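/- Dispersive-Hardy-Littlewood-Sobolev bound: for n ∈ ℕ and 2 ≤ p < 2*, ‖∫_0^t e^{i(t−τ)Δ} f(τ) dτ‖_{L^{γ(p)}(I, L^{p,2})} ≲ ‖f‖_{L^{γ(p)'}(I, L^{p',2})} for any interval I ⊂ [0,∞) containing 0, where 1/γ(p) = (n/2)(1/2 − 1/p). -/

import Mathlib

open MeasureTheory ENNReal Set Filter

noncomputable section

abbrev Rn (n : ℕ) := EuclideanSpace ℝ (Fin n)

/-- Decreasing rearrangement of `f` with respect to `μ`. -/
def rearrangement {α : Type*} [MeasurableSpace α] (μ : Measure α)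
    {E : Type*} [NNNorm E] (f : α → E) (t : ℝ) : ℝ≥0∞ :=
  sInf {l : ℝ≥0∞ | μ {x | l < (‖f x‖₊ : ℝ≥0∞)} ≤ ENNReal.ofReal t}

/-- Lorentz quasinorm `‖f‖_{L^{p,q}}` defined via the decreasing rearrangement. -/
def lorentzNorm {α : Type*} [MeasurableSpace α] {E : Type*} [NNNorm E]
    (μ : Measure α) (p q : ℝ≥0∞) (f : α → E) : ℝ≥0∞ :=
  if q = ∞ then ⨆ t ∈ Ioi (0:ℝ), ENNReal.ofReal (t ^ p.toReal⁻¹) * rearrangement μ f t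
  else (∫⁻ t in Ioi (0:ℝ),
      (ENNReal.ofReal (t ^ p.toReal⁻¹) * rearrangement μ f t) ^ q.toReal
        * ENNReal.ofReal t⁻¹) ^ q.toReal⁻¹

/-- `‖f‖_{L^{p,2}(ℝ^n)}`. -/
def lornorm (n : ℕ) (p : ℝ) (f : Rn n → ℂ) : ℝ≥0∞ :=
  lorentzNorm volume (ENNReal.ofReal p) 2 f

/-- The free Schrödinger propagator `e^{itΔ}` on `ℝ^n`, given by convolution with
`(4πit)^{-n/2} e^{i|x|²/(4t)}`. -/
def schrodinger (n : ℕ) (t : ℝ) (f : Rn n → ℂ) : Rn n → ℂ := fun x =>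
  (4 * (Real.pi : ℂ) * Complex.I * (t : ℂ)) ^ (-(n : ℂ) / 2) *
    ∫ y : Rn n, Complex.exp (Complex.I * ((‖x - y‖ : ℂ)) ^ 2 / (4 * (t : ℂ))) * f y

/-- The Strichartz exponent `γ(p)` with `1/γ(p) = (n/2)(1/2 - 1/p)` (so `γ(2) = ∞`). -/
def gam (n : ℕ) (p : ℝ) : ℝ≥0∞ := (ENNReal.ofReal ((n / 2 : ℝ) * (1/2 - 1/p)))⁻¹

/-- Hölder conjugate of an extended-real exponent. -/
def conjE (p : ℝ≥0∞) : ℝ≥0∞ := (1 - p⁻¹)⁻¹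

/-- Mixed space-time norm `‖f‖_{L^γ(I, X)}` given the map `t ↦ ‖f(t)‖_X`. -/
def timeNorm (γ : ℝ≥0∞) (I : Set ℝ) (N : ℝ → ℝ≥0∞) : ℝ≥0∞ :=
  if γ = ∞ then essSup N (volume.restrict I)
  else (∫⁻ t in I, N t ^ γ.toReal) ^ γ.toReal⁻¹

/-- `2 ≤ p < 2*` where `2* = 2n/(n-2)` for `n ≥ 3` and `2* = ∞` for `n = 1, 2`. -/
def subcrit (n : ℕ) (p : ℝ) : Prop := 2 ≤ p ∧ (3 ≤ n → p < 2 * n / (n - 2))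

/-- Duhamel operator `A_S f (t) = ∫_{t₀}^t e^{i(t-τ)Δ} f(τ) dτ`. -/
def duhamel (n : ℕ) (t₀ : ℝ) (f : ℝ → Rn n → ℂ) (t : ℝ) : Rn n → ℂ :=
  fun x => ∫ τ in t₀..t, schrodinger n (t - τ) (f τ) x

/-- The inhomogeneous nonlinearity `|x|^{-b} |u|^σ u`. -/
def nonlin (n : ℕ) (b σ : ℝ) (u : Rn n → ℂ) : Rn n → ℂ := fun x =>
  Complex.ofReal (‖x‖ ^ (-b)) * (Complex.ofReal (‖u x‖ ^ σ) * u x)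

/-- Laplacian on `ℝ^n` of a complex-valued function. -/
def lap (n : ℕ) (f : Rn n → ℂ) (x : Rn n) : ℂ :=
  ∑ i : Fin n, fderiv ℝ (fun y => fderiv ℝ f y (EuclideanSpace.single i 1)) x
    (EuclideanSpace.single i 1)

/-- `u` solves `i ∂_t u + Δ u = λ |x|^{-b} |u|^σ u` classically away from `x = 0`. -/
def solvesINLS (n : ℕ) (b σ : ℝ) (lam : ℂ) (u : ℝ → Rn n → ℂ) : Prop :=
  ∀ t : ℝ, ∀ x : Rn n, x ≠ 0 →
    Complex.I * deriv (fun s => u s x) t + lap n (u t) x =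
      lam * Complex.ofReal (‖x‖ ^ (-b)) * (Complex.ofReal (‖u t x‖ ^ σ) * u t x)

/-- Peetre K-functional for the couple `(L²(ℝ^n), L^r(ℝ^n))`. -/
def Kfun (n : ℕ) (r : ℝ) (t : ℝ) (f : Rn n → ℂ) : ℝ≥0∞ :=
  ⨅ g : Rn n → ℂ,
    eLpNorm g 2 volume + ENNReal.ofReal t * eLpNorm (f - g) (ENNReal.ofReal r) volume

/-- Real interpolation norm for `(L², L^r)_{θ,2}` by the K-method. -/
def interpNorm (n : ℕ) (r θ : ℝ) (f : Rn n → ℂ) : ℝ≥0∞ :=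
  (∫⁻ t in Ioi (0:ℝ), (ENNReal.ofReal (t ^ (-θ)) * Kfun n r t f) ^ (2:ℝ)
    * ENNReal.ofReal t⁻¹) ^ ((2:ℝ)⁻¹)

/-- `u` is a solution of the Duhamel equation for INLS with data `u₀` on the time set `I`,
belonging to `L^{γ(r)}(I, L^{r,2})`. -/
def IsSolOn (n : ℕ) (b σ r : ℝ) (lam : ℂ) (u₀ : Rn n → ℂ) (I : Set ℝ)
    (u : ℝ → Rn n → ℂ) : Prop :=
  Measurable (fun q : ℝ × Rn n => u q.1 q.2) ∧
  timeNorm (gam n r) I (fun t => lornorm n r (u t)) < ∞ ∧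
  ∀ t ∈ I, ∀ᵐ x : Rn n ∂volume, u t x = schrodinger n t u₀ x -
    Complex.I * lam * duhamel n 0 (fun τ => nonlin n b σ (u τ)) t x

end

section LayerCake

lemma volume_Ioi_ofReal_lt (a : ℝ≥0∞) :
    volume {l : ℝ | l ∈ Ioi (0:ℝ) ∧ ENNReal.ofReal l < a} = a := by
  by_cases ha : a = ∞
  · have : {l : ℝ | l ∈ Ioi (0:ℝ) ∧ ENNReal.ofReal l < a} = Ioi 0 := by
      ext l; simp [ha]
    rw [this, Real.volume_Ioi, ha]
  · have : {l : ℝ | l ∈ Ioi (0:ℝ) ∧ ENNReal.ofReal l < a} = Ioo 0 a.toReal := by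
      ext l
      simp only [mem_Ioi, mem_ofPred_eq, mem_Ioo]
      constructor
      · rintro ⟨h0, h⟩
        exact ⟨h0, (ENNReal.ofReal_lt_iff_lt_toReal h0.le ha).1 h⟩
      · rintro ⟨h0, h⟩
        exact ⟨h0, (ENNReal.ofReal_lt_iff_lt_toReal h0.le ha).2 h⟩
    rw [this, Real.volume_Ioo, sub_zero, ENNReal.ofReal_toReal ha]

/-- Layer cake formula for functions with values in `ℝ≥0∞`. -/
lemma lintegral_eq_lintegral_Ioi_meas_lt {α : Type*} [MeasurableSpace α] (μ : Measure α)
    [SFinite μ] {X : α → ℝ≥0∞} (hX : Measurable X) :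
    ∫⁻ x, X x ∂μ = ∫⁻ l in Ioi (0:ℝ), μ {x | ENNReal.ofReal l < X x} := by
  have hS : MeasurableSet {q : α × ℝ | ENNReal.ofReal q.2 < X q.1} :=
    measurableSet_lt (by fun_prop) (by fun_prop)
  calc ∫⁻ x, X x ∂μ
      = ∫⁻ x, (∫⁻ l in Ioi (0:ℝ),
          {q : α × ℝ | ENNReal.ofReal q.2 < X q.1}.indicator (fun _ => (1:ℝ≥0∞)) (x, l)) ∂μ := by
        refine lintegral_congr fun x => ?_
        have hm : MeasurableSet {l : ℝ | ENNReal.ofReal l < X x} :=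
          measurableSet_lt (by fun_prop) (by fun_prop)
        have : (fun l : ℝ => {q : α × ℝ | ENNReal.ofReal q.2 < X q.1}.indicator
            (fun _ => (1:ℝ≥0∞)) (x, l)) =
            {l : ℝ | ENNReal.ofReal l < X x}.indicator (fun _ => (1:ℝ≥0∞)) := by
          ext l; simp [indicator]
        rw [this, lintegral_indicator hm, lintegral_const, one_mul,
          Measure.restrict_apply_univ, Measure.restrict_apply hm]
        conv_lhs => rw [← volume_Ioi_ofReal_lt (X x)]
        congr 1
        ext l; simp [and_comm]
    _ = ∫⁻ l in Ioi (0:ℝ), ∫⁻ x,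
          {q : α × ℝ | ENNReal.ofReal q.2 < X q.1}.indicator (fun _ => (1:ℝ≥0∞)) (x, l) ∂μ := by
        apply lintegral_lintegral_swap
        exact (measurable_const.indicator hS).aemeasurable
    _ = _ := by
        congr 1 with l
        have hm : MeasurableSet {x | ENNReal.ofReal l < X x} :=
          measurableSet_lt (by fun_prop) (by fun_prop)
        have : (fun x : α => {q : α × ℝ | ENNReal.ofReal q.2 < X q.1}.indicator
            (fun _ => (1:ℝ≥0∞)) (x, l)) =
            {x | ENNReal.ofReal l < X x}.indicator (fun _ => (1:ℝ≥0∞)) := by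
          ext l; simp [indicator]
        rw [this, lintegral_indicator hm, lintegral_const, one_mul,
          Measure.restrict_apply_univ]

/-- Functions with the same distribution function have the same integral after composition
with a map whose superlevel sets are open upper rays. -/
lemma lintegral_comp_eq_of_meas_lt_eq {α β : Type*} [MeasurableSpace α] [MeasurableSpace β]
    {μ : Measure α} {ν : Measure β} [SFinite μ] [SFinite ν] {X : α → ℝ≥0∞} {Y : β → ℝ≥0∞}
    (hX : Measurable X) (hY : Measurable Y) (h : ∀ l, μ {x | l < X x} = ν {y | l < Y y})
    {T : ℝ≥0∞ → ℝ≥0∞} (hT : ∀ l, ∃ m, ∀ a, l < T a ↔ m < a) :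
    ∫⁻ x, T (X x) ∂μ = ∫⁻ y, T (Y y) ∂ν := by
  have hTm : Measurable T := by
    refine measurable_of_Ioi fun l => ?_
    obtain ⟨m, hm⟩ := hT l
    have : T ⁻¹' Ioi l = Ioi m := by ext a; simp [hm]
    rw [this]; exact measurableSet_Ioi
  have h1 := lintegral_eq_lintegral_Ioi_meas_lt μ (hTm.comp hX)
  have h2 := lintegral_eq_lintegral_Ioi_meas_lt ν (hTm.comp hY)
  simp only [Function.comp_apply] at h1 h2
  rw [h1, h2]
  congr 1 with l
  obtain ⟨m, hm⟩ := hT (ENNReal.ofReal l)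
  simp only [hm, h]

end LayerCake

section Rearrangement

variable {α : Type*} [MeasurableSpace α] {μ : Measure α} {f : α → ℂ}

lemma lt_rearrangement_iff (l : ℝ≥0∞) (s : ℝ) :
    l < rearrangement μ f s ↔ ENNReal.ofReal s < μ {x | l < ‖f x‖ₑ} := by
  constructor
  · intro h
    by_contra! hc
    exact absurd h (not_lt.2 (sInf_le hc))
  · intro h
    have hl : l ≠ ∞ := by
      rintro rfl
      simp at h
    obtain ⟨u, hu, hul, hlim⟩ := exists_seq_strictAnti_tendsto' (lt_top_iff_ne_top.2 hl)
    have hU : {x | l < ‖f x‖ₑ} = ⋃ k, {x | u k < ‖f x‖ₑ} := by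
      ext x
      simp only [mem_ofPred_eq, mem_iUnion]
      constructor
      · intro hx
        exact ((tendsto_order.1 hlim).2 _ hx).exists
      · rintro ⟨k, hk⟩
        exact (hul k).1.trans hk
    have hmono : Monotone fun k => {x | u k < ‖f x‖ₑ} := by
      intro i j hij x hx
      exact lt_of_le_of_lt (hu.antitone hij) hx
    rw [hU, hmono.measure_iUnion, lt_iSup_iff] at h
    obtain ⟨k, hk⟩ := h
    refine lt_of_lt_of_le (hul k).1 (le_sInf fun m hm => ?_)
    by_contra! hmk
    refine absurd (hk.trans_le ((measure_mono ?_).trans hm)) (lt_irrefl _)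
    intro x hx
    exact hmk.trans hx

lemma rearrangement_antitone : Antitone (rearrangement μ f) := by
  intro s t hst
  refine le_of_forall_lt fun l hl => ?_
  rw [lt_rearrangement_iff] at hl ⊢
  exact (ENNReal.ofReal_le_ofReal hst).trans_lt hl

lemma measurable_rearrangement : Measurable (rearrangement μ f) :=
  rearrangement_antitone.measurable

lemma volume_lt_rearrangement (l : ℝ≥0∞) :
    volume.restrict (Ioi (0:ℝ)) {s | l < rearrangement μ f s} = μ {x | l < ‖f x‖ₑ} := by
  rw [Measure.restrict_apply (measurableSet_lt measurable_const measurable_rearrangement)]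
  conv_rhs => rw [← volume_Ioi_ofReal_lt (μ {x | l < ‖f x‖ₑ})]
  congr 1
  ext s
  simp [lt_rearrangement_iff, and_comm]

lemma lintegral_comp_rearrangement [SFinite μ] (hf : Measurable f)
    {T : ℝ≥0∞ → ℝ≥0∞} (hT : ∀ l, ∃ m, ∀ a, l < T a ↔ m < a) :
    ∫⁻ x, T ‖f x‖ₑ ∂μ = ∫⁻ s in Ioi (0:ℝ), T (rearrangement μ f s) :=
  lintegral_comp_eq_of_meas_lt_eq hf.enorm measurable_rearrangement
    (fun l => (volume_lt_rearrangement l).symm) hT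

lemma lt_sq_iff_sqrt_lt (l a : ℝ≥0∞) : l < a ^ (2:ℝ) ↔ l ^ ((2:ℝ)⁻¹) < a := by
  rw [ENNReal.rpow_inv_lt_iff (by norm_num)]

lemma lintegral_sq_rearrangement [SFinite μ] (hf : Measurable f) :
    ∫⁻ s in Ioi (0:ℝ), rearrangement μ f s ^ (2:ℝ) = ∫⁻ x, ‖f x‖ₑ ^ (2:ℝ) ∂μ :=
  (lintegral_comp_rearrangement (T := fun a => a ^ (2:ℝ)) hf
    fun l => ⟨_, fun a => lt_sq_iff_sqrt_lt l a⟩).symm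

lemma lintegral_large_le [SFinite μ] (hf : Measurable f) (u : ℝ) :
    ∫⁻ x, {x | rearrangement μ f u < ‖f x‖ₑ}.indicator (fun x => ‖f x‖ₑ) x ∂μ ≤
      ∫⁻ s in Ioo (0:ℝ) u, rearrangement μ f s := by
  set c := rearrangement μ f u with hc
  have h := lintegral_comp_rearrangement (μ := μ) (T := fun a => if c < a then a else 0) hf
    (fun l => ⟨max l c, fun a => by
      by_cases h : c < a <;> simp [h]⟩)
  have h1 : ∫⁻ x, {x | c < ‖f x‖ₑ}.indicator (fun x => ‖f x‖ₑ) x ∂μ =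
      ∫⁻ s in Ioi (0:ℝ), (if c < rearrangement μ f s then rearrangement μ f s else 0) := by
    rw [← h]
    exact lintegral_congr fun x => by simp [indicator]
  rw [h1, ← lintegral_indicator measurableSet_Ioi, ← lintegral_indicator measurableSet_Ioo]
  refine lintegral_mono fun s => ?_
  by_cases hs : s ∈ Ioi (0:ℝ)
  · by_cases hcs : c < rearrangement μ f s
    · have : s < u := by
        by_contra! hus
        exact absurd hcs (not_lt.2 (rearrangement_antitone hus))
      have hm : s ∈ Ioo 0 u := ⟨hs, this⟩
      simp [indicator, hcs, hm, hs]
    · simp [hcs, indicator]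
  · simp [hs]

lemma lintegral_small_le [SFinite μ] (hf : Measurable f) {u : ℝ} (hu : 0 < u) :
    ∫⁻ x, {x | ‖f x‖ₑ ≤ rearrangement μ f u}.indicator (fun x => ‖f x‖ₑ ^ (2:ℝ)) x ∂μ ≤
      ENNReal.ofReal u * rearrangement μ f u ^ (2:ℝ)
        + ∫⁻ s in Ioi u, rearrangement μ f s ^ (2:ℝ) := by
  set c := rearrangement μ f u with hc
  have h := lintegral_comp_rearrangement (μ := μ) (T := fun a => min (a ^ (2:ℝ)) (c ^ (2:ℝ))) hf
    (fun l => by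
      by_cases h : l < c ^ (2:ℝ)
      · exact ⟨_, fun a => by simp only [lt_min_iff, h, and_true]; exact lt_sq_iff_sqrt_lt l a⟩
      · exact ⟨∞, fun a => by simp only [lt_min_iff, h, and_false, not_top_lt]⟩)
  calc ∫⁻ x, {x | ‖f x‖ₑ ≤ c}.indicator (fun x => ‖f x‖ₑ ^ (2:ℝ)) x ∂μ
      ≤ ∫⁻ x, min (‖f x‖ₑ ^ (2:ℝ)) (c ^ (2:ℝ)) ∂μ := by
        refine lintegral_mono fun x => ?_
        by_cases hx : ‖f x‖ₑ ≤ c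
        · simpa [indicator, hx] using ENNReal.rpow_le_rpow hx (by norm_num : (0:ℝ) ≤ 2)
        · simp [indicator, hx]
    _ = ∫⁻ s in Ioi (0:ℝ), min (rearrangement μ f s ^ (2:ℝ)) (c ^ (2:ℝ)) := h
    _ = (∫⁻ s in Ioc 0 u, min (rearrangement μ f s ^ (2:ℝ)) (c ^ (2:ℝ)))
        + ∫⁻ s in Ioi u, min (rearrangement μ f s ^ (2:ℝ)) (c ^ (2:ℝ)) := by
        rw [← Ioc_union_Ioi_eq_Ioi hu.le, lintegral_union measurableSet_Ioi]
        exact Set.disjoint_left.2 fun x hx hx' => absurd hx.2 (not_le.2 hx')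
    _ ≤ _ := by
        refine add_le_add ?_ (lintegral_mono fun s => min_le_left _ _)
        calc _ ≤ ∫⁻ s in Ioc 0 u, c ^ (2:ℝ) := lintegral_mono fun s => min_le_right _ _
          _ = _ := by simp [mul_comm]

end Rearrangement

section Propagator

open ComplexConjugate

/-- The oscillatory phase of the Schrödinger kernel. -/
noncomputable def schrodingerPhase (n : ℕ) (t : ℝ) (x y : Rn n) : ℂ :=
  Complex.exp (Complex.I * ((‖x - y‖ : ℂ)) ^ 2 / (4 * (t : ℂ)))

lemma schrodingerPhase_eq_exp_ofReal (n : ℕ) (t : ℝ) (x y : Rn n) :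
    schrodingerPhase n t x y = Complex.exp (((‖x - y‖ ^ 2 / (4 * t) : ℝ) : ℂ) * Complex.I) := by
  unfold schrodingerPhase
  congr 1
  push_cast
  ring

lemma norm_schrodingerPhase (n : ℕ) (t : ℝ) (x y : Rn n) : ‖schrodingerPhase n t x y‖ = 1 := by
  rw [schrodingerPhase_eq_exp_ofReal, Complex.norm_exp_ofReal_mul_I]

lemma measurable_schrodingerPhase (n : ℕ) :
    Measurable fun q : ℝ × Rn n × Rn n => schrodingerPhase n q.1 q.2.1 q.2.2 := by
  unfold schrodingerPhase
  fun_prop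

lemma measurable_schrodingerPhase_fixed (n : ℕ) (t : ℝ) :
    Measurable fun q : Rn n × Rn n => schrodingerPhase n t q.1 q.2 := by
  unfold schrodingerPhase
  fun_prop

lemma integrable_schrodingerPhase_mul_iff {n : ℕ} {t : ℝ} {x : Rn n} {f : Rn n → ℂ} :
    Integrable (fun y => schrodingerPhase n t x y * f y) ↔ Integrable f := by
  have hm : Measurable fun y => schrodingerPhase n t x y := by
    unfold schrodingerPhase
    fun_prop
  constructor
  · intro h
    have h2 := h.bdd_mul (f := fun y => conj (schrodingerPhase n t x y)) (c := 1)
      (Complex.continuous_conj.measurable.comp hm).aestronglyMeasurable (Eventually.of_forall fun y => by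
        rw [RCLike.norm_conj, norm_schrodingerPhase])
    refine h2.congr (Eventually.of_forall fun y => ?_)
    simp only
    rw [← mul_assoc, mul_comm (conj _), Complex.mul_conj, Complex.normSq_eq_norm_sq,
      norm_schrodingerPhase]
    simp
  · intro h
    exact h.bdd_mul (c := 1) hm.aestronglyMeasurable
      (Eventually.of_forall fun y => (norm_schrodingerPhase n t x y).le)

lemma norm_integral_phase_gaussian {n : ℕ} {t ε : ℝ} (ht : t ≠ 0) (hε : 0 < ε) (y z : Rn n) :
    ‖∫ x : Rn n, schrodingerPhase n t x y * conj (schrodingerPhase n t x z)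
        * (Real.exp (-ε * ‖x‖ ^ 2) : ℂ)‖ =
      (Real.pi / ε) ^ ((n : ℝ) / 2) * Real.exp (-(1 / (16 * t ^ 2 * ε)) * ‖y - z‖ ^ 2) := by
  have hεc : 0 < (ε : ℂ).re := by simpa using hε
  have key : ∀ x : Rn n, schrodingerPhase n t x y * conj (schrodingerPhase n t x z)
        * (Real.exp (-ε * ‖x‖ ^ 2) : ℂ) =
      Complex.exp (((‖y‖ ^ 2 - ‖z‖ ^ 2) / (4 * t) : ℝ) * Complex.I) *
      Complex.exp (-(ε:ℂ) * ‖x‖ ^ 2 + (-Complex.I / (2 * t)) * (inner ℝ (y - z) x : ℝ)) := by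
    intro x
    rw [schrodingerPhase_eq_exp_ofReal, schrodingerPhase_eq_exp_ofReal, ← Complex.exp_conj,
      Complex.ofReal_exp, ← Complex.exp_add, ← Complex.exp_add, ← Complex.exp_add]
    congr 1
    have h1 : ‖x - y‖ ^ 2 = ‖x‖ ^ 2 - 2 * inner ℝ y x + ‖y‖ ^ 2 := by
      rw [norm_sub_sq_real, real_inner_comm]
    have h2 : ‖x - z‖ ^ 2 = ‖x‖ ^ 2 - 2 * inner ℝ z x + ‖z‖ ^ 2 := by
      rw [norm_sub_sq_real, real_inner_comm]
    rw [h1, h2, inner_sub_left]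
    have ht' : (t : ℂ) ≠ 0 := by exact_mod_cast ht
    simp only [map_mul, Complex.conj_ofReal, Complex.conj_I]
    push_cast
    field_simp
    ring
  simp_rw [key]
  rw [integral_const_mul, GaussianFourier.integral_cexp_neg_mul_sq_norm_add hεc, norm_mul,
    Complex.norm_exp_ofReal_mul_I, one_mul, norm_mul]
  have hpos : 0 < Real.pi / ε := by positivity
  congr 1
  · rw [finrank_euclideanSpace_fin,
      show ((Real.pi : ℂ) / (ε : ℂ)) = ((Real.pi / ε : ℝ) : ℂ) by push_cast; rfl,
      show ((n : ℂ) / 2) = (((n : ℝ) / 2 : ℝ) : ℂ) by push_cast; rfl,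
      ← Complex.ofReal_cpow hpos.le, Complex.norm_real, Real.norm_of_nonneg (by positivity)]
  · rw [show (-Complex.I / (2 * (t:ℂ))) ^ 2 * (‖y - z‖ : ℂ) ^ 2 / (4 * (ε : ℂ)) =
      ((-(1 / (16 * t ^ 2 * ε)) * ‖y - z‖ ^ 2 : ℝ) : ℂ) by
        have ht' : (t : ℂ) ≠ 0 := by exact_mod_cast ht
        have hε' : (ε : ℂ) ≠ 0 := by exact_mod_cast hε.ne'
        push_cast
        field_simp
        rw [Complex.I_sq]
        ring, ← Complex.ofReal_exp, Complex.norm_real, Real.norm_of_nonneg (by positivity)]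

lemma lintegral_gaussian_eq {n : ℕ} {b : ℝ} (hb : 0 < b) (z : Rn n) :
    ∫⁻ y : Rn n, ENNReal.ofReal (Real.exp (-b * ‖y - z‖ ^ 2)) =
      ENNReal.ofReal ((Real.pi / b) ^ ((n : ℝ) / 2)) := by
  rw [lintegral_sub_right_eq_self (fun y : Rn n => ENNReal.ofReal (Real.exp (-b * ‖y‖ ^ 2))) z,
    ← ofReal_integral_eq_lintegral_ofReal]
  · rw [GaussianFourier.integral_rexp_neg_mul_sq_norm hb, finrank_euclideanSpace_fin]
  · have h := (GaussianFourier.integrable_cexp_neg_mul_sq_norm_add (b := (b : ℂ))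
      (by simpa using hb) 0 (0 : Rn n)).norm
    refine h.congr (Eventually.of_forall fun v => ?_)
    simp only [inner_zero_left, Complex.ofReal_zero, mul_zero, add_zero]
    rw [show -(b:ℂ) * (‖v‖:ℂ) ^ 2 = ((-b * ‖v‖ ^ 2 : ℝ) : ℂ) by push_cast; rfl,
      ← Complex.ofReal_exp, Complex.norm_real, Real.norm_of_nonneg (by positivity)]
  · exact Eventually.of_forall fun v => (Real.exp_pos _).le

end Propagator

section EnergyBound

open ComplexConjugate

lemma measurable_integral_schrodingerPhase {n : ℕ} (t : ℝ) {f : Rn n → ℂ} (hf : Measurable f) :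
    Measurable fun x => ∫ y, schrodingerPhase n t x y * f y := by
  have h : StronglyMeasurable (Function.uncurry fun x y => schrodingerPhase n t x y * f y) :=
    ((measurable_schrodingerPhase_fixed n t).mul (hf.comp measurable_snd)).stronglyMeasurable
  exact h.integral_prod_right.measurable

lemma lintegral_mul_mul_gaussian_le {n : ℕ} {b : ℝ} (hb : 0 < b) {F : Rn n → ℝ≥0∞}
    (hF : Measurable F) :
    ∫⁻ q : Rn n × Rn n, F q.1 * F q.2 * ENNReal.ofReal (Real.exp (-b * ‖q.1 - q.2‖ ^ 2)) ≤
      ENNReal.ofReal ((Real.pi / b) ^ ((n : ℝ) / 2)) * ∫⁻ y, F y ^ (2:ℝ) := by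
  set H : Rn n → Rn n → ℝ≥0∞ := fun y z => ENNReal.ofReal (Real.exp (-b * ‖y - z‖ ^ 2)) with hH
  set κ := ENNReal.ofReal ((Real.pi / b) ^ ((n : ℝ) / 2)) with hκ
  have hHm : Measurable fun q : Rn n × Rn n => H q.1 q.2 := by
    simp only [hH]; fun_prop
  have hHsymm : ∀ y z, H y z = H z y := fun y z => by simp only [hH, norm_sub_rev]
  have hHint : ∀ z, ∫⁻ y, H y z = κ := fun z => lintegral_gaussian_eq hb z
  have hone : ∫⁻ q : Rn n × Rn n, F q.1 ^ (2:ℝ) * H q.1 q.2 = κ * ∫⁻ y, F y ^ (2:ℝ) := by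
    rw [Measure.volume_eq_prod, lintegral_prod _ (by fun_prop)]
    simp only
    have : ∀ y, ∫⁻ z, F y ^ (2:ℝ) * H y z = κ * F y ^ (2:ℝ) := by
      intro y
      rw [lintegral_const_mul _ (by fun_prop)]
      simp_rw [hHsymm y]
      rw [hHint, mul_comm]
    simp_rw [this]
    rw [lintegral_const_mul _ (by fun_prop)]
  have htwo : ∫⁻ q : Rn n × Rn n, F q.2 ^ (2:ℝ) * H q.1 q.2 = κ * ∫⁻ y, F y ^ (2:ℝ) := by
    rw [← hone, Measure.volume_eq_prod, ← lintegral_prod_swap]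
    simp only [Prod.fst_swap, Prod.snd_swap]
    simp_rw [hHsymm]
  calc ∫⁻ q : Rn n × Rn n, F q.1 * F q.2 * H q.1 q.2
      ≤ ∫⁻ q : Rn n × Rn n, (F q.1 ^ (2:ℝ) * H q.1 q.2 / 2 + F q.2 ^ (2:ℝ) * H q.1 q.2 / 2) := by
        refine lintegral_mono fun q => ?_
        have h := ENNReal.young_inequality (F q.1) (F q.2) (p := 2) (q := 2)
          ⟨by norm_num, by norm_num, by norm_num⟩
        rw [ENNReal.ofReal_ofNat] at h
        calc _ ≤ (F q.1 ^ (2:ℝ) / 2 + F q.2 ^ (2:ℝ) / 2) * H q.1 q.2 := by gcongr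
          _ = _ := by
            simp only [div_eq_mul_inv]
            ring
    _ = κ * ∫⁻ y, F y ^ (2:ℝ) := by
        rw [lintegral_add_left (by fun_prop)]
        simp only [div_eq_mul_inv]
        rw [lintegral_mul_const _ (by fun_prop), lintegral_mul_const _ (by fun_prop), hone, htwo,
          ← mul_add, ENNReal.inv_two_add_inv_two, mul_one]

lemma lintegral_sq_phase_gaussian_le {n : ℕ} {t ε : ℝ} (ht : t ≠ 0) (hε : 0 < ε)
    {f : Rn n → ℂ} (hf : Measurable f) (hfi : Integrable f) :
    ∫⁻ x, ‖∫ y, schrodingerPhase n t x y * f y‖ₑ ^ (2:ℝ)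
        * ENNReal.ofReal (Real.exp (-ε * ‖x‖ ^ 2)) ≤
      ENNReal.ofReal ((4 * Real.pi * |t|) ^ (n : ℝ)) * ∫⁻ y, ‖f y‖ₑ ^ (2:ℝ) := by
  set g : Rn n → ℂ := fun x => ∫ y, schrodingerPhase n t x y * f y with hg
  set W : Rn n → ℂ := fun x => (Real.exp (-ε * ‖x‖ ^ 2) : ℂ) with hW
  have hWi : Integrable W := by
    have h := GaussianFourier.integrable_cexp_neg_mul_sq_norm_add (b := (ε : ℂ))
      (by simpa using hε) 0 (0 : Rn n)
    refine h.congr (Eventually.of_forall fun v => ?_)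
    simp [hW]
  set Φ : Rn n × (Rn n × Rn n) → ℂ := fun q =>
    (schrodingerPhase n t q.1 q.2.1 * conj (schrodingerPhase n t q.1 q.2.2)) *
      (W q.1 * (f q.2.1 * conj (f q.2.2))) with hΦ
  have hff : Integrable (fun r : Rn n × Rn n => f r.1 * conj (f r.2)) := by
    have hc : Integrable (fun y => conj (f y)) := by
      exact hfi.norm.mono' (Complex.continuous_conj.measurable.comp hf).aestronglyMeasurable
        (Eventually.of_forall fun y => by simp)
    exact hfi.mul_prod hc
  have hΦi : Integrable Φ := by
    refine (hWi.mul_prod hff).bdd_mul (c := 1) ?_ (Eventually.of_forall fun q => ?_)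
    · have h1 : Measurable fun q : Rn n × (Rn n × Rn n) => schrodingerPhase n t q.1 q.2.1 := by
        unfold schrodingerPhase
        fun_prop
      have h2 : Measurable fun q : Rn n × (Rn n × Rn n) => schrodingerPhase n t q.1 q.2.2 := by
        unfold schrodingerPhase
        fun_prop
      exact (h1.mul (Complex.continuous_conj.measurable.comp h2)).aestronglyMeasurable
    · rw [norm_mul, RCLike.norm_conj, norm_schrodingerPhase, norm_schrodingerPhase, one_mul]
  have hinner : ∀ x, ∫ r : Rn n × Rn n, Φ (x, r) = g x * conj (g x) * W x := by
    intro x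
    have : ∀ r : Rn n × Rn n, Φ (x, r) = W x *
        ((fun y => schrodingerPhase n t x y * f y) r.1 *
          (fun z => conj (schrodingerPhase n t x z * f z)) r.2) := by
      intro r
      simp only [hΦ, map_mul]
      ring
    rw [integral_congr_ae (Eventually.of_forall this), integral_const_mul,
      Measure.volume_eq_prod,
      integral_prod_mul (fun y => schrodingerPhase n t x y * f y)
        (fun z => conj (schrodingerPhase n t x z * f z)), integral_conj]
    ring
  have hGi : Integrable (fun x => g x * conj (g x) * W x) := by
    refine hΦi.integral_prod_left.congr (Eventually.of_forall hinner)
  have hGnorm : ∀ x, g x * conj (g x) * W x = ((‖g x * conj (g x) * W x‖ : ℝ) : ℂ) := by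
    intro x
    rw [Complex.mul_conj, Complex.normSq_eq_norm_sq, ← Complex.ofReal_mul, Complex.norm_real,
      Real.norm_of_nonneg (by positivity)]
  have hlhs : ∫⁻ x, ‖g x‖ₑ ^ (2:ℝ) * ENNReal.ofReal (Real.exp (-ε * ‖x‖ ^ 2)) =
      ‖∫ x, g x * conj (g x) * W x‖ₑ := by
    have h1 : ∀ x, ‖g x‖ₑ ^ (2:ℝ) * ENNReal.ofReal (Real.exp (-ε * ‖x‖ ^ 2)) =
        ENNReal.ofReal ‖g x * conj (g x) * W x‖ := by
      intro x
      rw [norm_mul, norm_mul, RCLike.norm_conj, hW, Complex.norm_real,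
        Real.norm_of_nonneg (Real.exp_pos _).le, ENNReal.ofReal_mul (by positivity),
        ENNReal.ofReal_mul (by positivity), ofReal_norm, ENNReal.rpow_two, sq]
    simp_rw [h1]
    rw [← ofReal_integral_eq_lintegral_ofReal hGi.norm
      (Eventually.of_forall fun x => norm_nonneg _)]
    rw [integral_congr_ae (Eventually.of_forall hGnorm), integral_complex_ofReal,
      ← ofReal_norm, Complex.norm_real, Real.norm_of_nonneg (integral_nonneg fun x => norm_nonneg _)]
  have hb : 0 < 1 / (16 * t ^ 2 * ε) := by positivity
  rw [hlhs]
  calc ‖∫ x, g x * conj (g x) * W x‖ₑ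
      = ‖∫ r : Rn n × Rn n, ∫ x, Φ (x, r)‖ₑ := by
        simp_rw [← hinner]
        rw [integral_integral_swap (f := fun x r => Φ (x, r)) hΦi]
    _ ≤ ∫⁻ r : Rn n × Rn n, ‖∫ x, Φ (x, r)‖ₑ := enorm_integral_le_lintegral_enorm _
    _ = ∫⁻ r : Rn n × Rn n, ENNReal.ofReal ((Real.pi / ε) ^ ((n : ℝ) / 2)) *
          (‖f r.1‖ₑ * ‖f r.2‖ₑ *
            ENNReal.ofReal (Real.exp (-(1 / (16 * t ^ 2 * ε)) * ‖r.1 - r.2‖ ^ 2))) := by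
        refine lintegral_congr fun r => ?_
        have : ∀ x, Φ (x, r) = (schrodingerPhase n t x r.1 *
            conj (schrodingerPhase n t x r.2) * W x) * (f r.1 * conj (f r.2)) := by
          intro x
          simp only [hΦ]
          ring
        simp_rw [this]
        rw [integral_mul_const, enorm_mul, enorm_mul, RCLike.enorm_conj,
          ← ofReal_norm, norm_integral_phase_gaussian ht hε,
          ENNReal.ofReal_mul (by positivity)]
        ring
    _ ≤ ENNReal.ofReal ((Real.pi / ε) ^ ((n : ℝ) / 2)) *
          (ENNReal.ofReal ((Real.pi / (1 / (16 * t ^ 2 * ε))) ^ ((n : ℝ) / 2)) *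
            ∫⁻ y, ‖f y‖ₑ ^ (2:ℝ)) := by
        rw [lintegral_const_mul _ (by fun_prop)]
        gcongr
        exact lintegral_mul_mul_gaussian_le hb hf.enorm
    _ = _ := by
        rw [← mul_assoc, ← ENNReal.ofReal_mul (by positivity),
          ← Real.mul_rpow (by positivity) (by positivity)]
        congr 2
        rw [show Real.pi / ε * (Real.pi / (1 / (16 * t ^ 2 * ε))) = (4 * Real.pi * |t|) ^ (2:ℝ) by
          rw [Real.rpow_two, mul_pow, sq_abs]
          field_simp
          ring, ← Real.rpow_mul (by positivity)]
        congr 1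
        ring

lemma lintegral_sq_phase_le {n : ℕ} {t : ℝ} (ht : t ≠ 0)
    {f : Rn n → ℂ} (hf : Measurable f) (hfi : Integrable f) :
    ∫⁻ x, ‖∫ y, schrodingerPhase n t x y * f y‖ₑ ^ (2:ℝ) ≤
      ENNReal.ofReal ((4 * Real.pi * |t|) ^ (n : ℝ)) * ∫⁻ y, ‖f y‖ₑ ^ (2:ℝ) := by
  set g : Rn n → ℂ := fun x => ∫ y, schrodingerPhase n t x y * f y with hg
  have hgm : Measurable g := measurable_integral_schrodingerPhase t hf
  set G : ℕ → Rn n → ℝ≥0∞ := fun k x =>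
    ‖g x‖ₑ ^ (2:ℝ) * ENNReal.ofReal (Real.exp (-(1 / ((k:ℝ) + 1)) * ‖x‖ ^ 2)) with hG
  have hlim : ∀ x, Tendsto (fun k => G k x) atTop (nhds (‖g x‖ₑ ^ (2:ℝ))) := by
    intro x
    have h1 : Tendsto (fun k : ℕ => Real.exp (-(1 / ((k:ℝ) + 1)) * ‖x‖ ^ 2)) atTop
        (nhds (Real.exp (-0 * ‖x‖ ^ 2))) :=
      (Real.continuous_exp.tendsto _).comp
        ((tendsto_one_div_add_atTop_nhds_zero_nat.neg).mul_const _)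
    have h2 := ENNReal.Tendsto.const_mul (a := ‖g x‖ₑ ^ (2:ℝ)) (ENNReal.tendsto_ofReal h1)
      (Or.inl (by simp))
    simpa [hG] using h2
  calc ∫⁻ x, ‖g x‖ₑ ^ (2:ℝ)
      = ∫⁻ x, liminf (fun k => G k x) atTop :=
        lintegral_congr fun x => (hlim x).liminf_eq.symm
    _ ≤ liminf (fun k => ∫⁻ x, G k x) atTop :=
        lintegral_liminf_le fun k => by simp only [hG]; fun_prop
    _ ≤ liminf (fun _ : ℕ => ENNReal.ofReal ((4 * Real.pi * |t|) ^ (n : ℝ)) *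
          ∫⁻ y, ‖f y‖ₑ ^ (2:ℝ)) atTop := by
        refine liminf_le_liminf (Eventually.of_forall fun k => ?_)
        exact lintegral_sq_phase_gaussian_le ht (by positivity) hf hfi
    _ = _ := by simp

lemma schrodinger_eq (n : ℕ) (t : ℝ) (f : Rn n → ℂ) (x : Rn n) :
    schrodinger n t f x = (4 * (Real.pi : ℂ) * Complex.I * (t : ℂ)) ^ (-(n : ℂ) / 2) *
      ∫ y, schrodingerPhase n t x y * f y := rfl

lemma norm_schrodinger_const (n : ℕ) {t : ℝ} (ht : 0 < t) :
    ‖(4 * (Real.pi : ℂ) * Complex.I * (t : ℂ)) ^ (-(n : ℂ) / 2)‖ =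
      (4 * Real.pi * t) ^ (-(n : ℝ) / 2) := by
  have h0 : (4 * (Real.pi : ℂ) * Complex.I * (t : ℂ)) = ((4 * Real.pi * t : ℝ) : ℂ) * Complex.I := by
    push_cast; ring
  have hpos : 0 < 4 * Real.pi * t := by positivity
  rw [h0, show (-(n : ℂ) / 2) = ((-(n : ℝ) / 2 : ℝ) : ℂ) by push_cast; rfl,
    Complex.norm_cpow_real, norm_mul, Complex.norm_I, Complex.norm_real,
    Real.norm_of_nonneg hpos.le, mul_one]

lemma schrodinger_of_not_integrable {n : ℕ} {t : ℝ} {f : Rn n → ℂ} (hf : ¬ Integrable f)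
    (x : Rn n) : schrodinger n t f x = 0 := by
  rw [schrodinger_eq, integral_undef (by rwa [integrable_schrodingerPhase_mul_iff]), mul_zero]

lemma schrodinger_add {n : ℕ} {t : ℝ} {f g : Rn n → ℂ} (hf : Integrable f) (hg : Integrable g)
    (x : Rn n) : schrodinger n t (f + g) x = schrodinger n t f x + schrodinger n t g x := by
  simp only [schrodinger_eq, Pi.add_apply, mul_add]
  rw [integral_add (integrable_schrodingerPhase_mul_iff.2 hf)
    (integrable_schrodingerPhase_mul_iff.2 hg), mul_add]

lemma enorm_schrodinger_le {n : ℕ} {t : ℝ} (ht : 0 < t) (f : Rn n → ℂ) (x : Rn n) :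
    ‖schrodinger n t f x‖ₑ ≤
      ENNReal.ofReal ((4 * Real.pi * t) ^ (-(n : ℝ) / 2)) * ∫⁻ y, ‖f y‖ₑ := by
  rw [schrodinger_eq, enorm_mul, ← ofReal_norm, norm_schrodinger_const n ht]
  gcongr
  refine (enorm_integral_le_lintegral_enorm _).trans (le_of_eq (lintegral_congr fun y => ?_))
  rw [enorm_mul, ← ofReal_norm (schrodingerPhase n t x y), norm_schrodingerPhase]
  simp

lemma measurable_schrodinger {n : ℕ} (t : ℝ) {f : Rn n → ℂ} (hf : Measurable f) :
    Measurable (schrodinger n t f) :=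
  (measurable_integral_schrodingerPhase t hf).const_mul _

lemma lintegral_sq_schrodinger_le {n : ℕ} {t : ℝ} (ht : 0 < t) {f : Rn n → ℂ}
    (hf : Measurable f) :
    ∫⁻ x, ‖schrodinger n t f x‖ₑ ^ (2:ℝ) ≤ ∫⁻ x, ‖f x‖ₑ ^ (2:ℝ) := by
  by_cases hfi : Integrable f
  · have hpos : 0 < 4 * Real.pi * t := by positivity
    have h1 : ∀ x, ‖schrodinger n t f x‖ₑ ^ (2:ℝ) =
        ENNReal.ofReal ((4 * Real.pi * t) ^ (-(n:ℝ))) *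
          ‖∫ y, schrodingerPhase n t x y * f y‖ₑ ^ (2:ℝ) := by
      intro x
      rw [schrodinger_eq, enorm_mul, ENNReal.mul_rpow_of_nonneg _ _ (by norm_num),
        ← ofReal_norm, norm_schrodinger_const n ht,
        ENNReal.ofReal_rpow_of_nonneg (by positivity) (by norm_num), ← Real.rpow_mul hpos.le]
      congr 3
      ring
    simp_rw [h1]
    rw [lintegral_const_mul _ ((measurable_integral_schrodingerPhase t hf).enorm.pow_const _)]
    calc _ ≤ ENNReal.ofReal ((4 * Real.pi * t) ^ (-(n:ℝ))) *
          (ENNReal.ofReal ((4 * Real.pi * |t|) ^ (n : ℝ)) * ∫⁻ y, ‖f y‖ₑ ^ (2:ℝ)) := by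
          gcongr
          exact lintegral_sq_phase_le ht.ne' hf hfi
      _ = _ := by
          rw [abs_of_pos ht, ← mul_assoc, ← ENNReal.ofReal_mul (by positivity),
            ← Real.rpow_add hpos]
          simp
  · simp [schrodinger_of_not_integrable hfi]

end EnergyBound

section DispersiveEstimate

/-- Bound for averages of a function that splits at height `h (1 / (A² s))` into a part controlled
by `A` times its `L¹` norm and a part controlled in `L²`. -/
noncomputable def couplingBound (A : ℝ) (h : ℝ → ℝ≥0∞) (s : ℝ) : ℝ≥0∞ :=
  2 * ENNReal.ofReal A * (∫⁻ v in Ioo 0 (1 / (A ^ 2 * s)), h v) +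
    ENNReal.ofReal (s ^ (-(1/2) : ℝ)) * (∫⁻ v in Ioi (1 / (A ^ 2 * s)), h v ^ (2:ℝ)) ^ (1/2 : ℝ)

lemma setLIntegral_le_sqrt_measure_mul {α : Type*} [MeasurableSpace α] {μ : Measure α}
    (E : Set α) {g : α → ℝ≥0∞} (hg : Measurable g) :
    ∫⁻ x in E, g x ∂μ ≤ μ E ^ (1/2 : ℝ) * (∫⁻ x, g x ^ (2:ℝ) ∂μ) ^ (1/2 : ℝ) := by
  have h := ENNReal.lintegral_mul_le_Lp_mul_Lq (μ.restrict E) (p := 2) (q := 2)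
    ⟨by norm_num, by norm_num, by norm_num⟩
    (f := fun _ => 1) (g := g) aemeasurable_const hg.aemeasurable
  simp only [Pi.mul_apply, one_mul, ENNReal.one_rpow, lintegral_const,
    Measure.restrict_apply_univ] at h
  refine h.trans ?_
  gcongr
  exact Measure.restrict_le_self

lemma setLIntegral_schrodinger_le {n : ℕ} {t : ℝ} (ht : 0 < t) {f : Rn n → ℂ} (hf : Measurable f)
    {E : Set (Rn n)} {s : ℝ} (hs : 0 < s) (hsE : ENNReal.ofReal s ≤ volume E)
    (hE : volume E ≠ ∞) :
    ∫⁻ x in E, ‖schrodinger n t f x‖ₑ ≤ volume E *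
      couplingBound ((4 * Real.pi * t) ^ (-(n : ℝ) / 2)) (rearrangement volume f) s := by
  by_cases hfi : Integrable f
  swap
  · simp [schrodinger_of_not_integrable hfi]
  set A := (4 * Real.pi * t) ^ (-(n : ℝ) / 2) with hA
  have hApos : 0 < A := by positivity
  set u := 1 / (A ^ 2 * s) with hu
  have hupos : 0 < u := by positivity
  set h := rearrangement volume f with hh
  set f₁ : Rn n → ℂ := {x | h u < ‖f x‖ₑ}.indicator f with hf₁
  set f₂ : Rn n → ℂ := {x | ‖f x‖ₑ ≤ h u}.indicator f with hf₂
  have hm₁ : MeasurableSet {x | h u < ‖f x‖ₑ} := measurableSet_lt measurable_const hf.enorm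
  have hm₂ : MeasurableSet {x | ‖f x‖ₑ ≤ h u} := measurableSet_le hf.enorm measurable_const
  have hadd : f = f₁ + f₂ := by
    ext x
    by_cases hx : h u < ‖f x‖ₑ
    · simp [hf₁, hf₂, indicator, hx]
    · simp [hf₁, hf₂, indicator, hx, not_lt.1 hx]
  have hint₁ : Integrable f₁ := hfi.indicator hm₁
  have hint₂ : Integrable f₂ := hfi.indicator hm₂
  have hf₁m : Measurable f₁ := hf.indicator hm₁
  have hf₂m : Measurable f₂ := hf.indicator hm₂
  have hL1 : ∫⁻ x, ‖f₁ x‖ₑ ≤ ∫⁻ v in Ioo 0 u, h v := by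
    refine le_trans (le_of_eq (lintegral_congr fun x => ?_)) (lintegral_large_le hf u)
    exact enorm_indicator_eq_indicator_enorm _ _
  have hL2 : ∫⁻ x, ‖f₂ x‖ₑ ^ (2:ℝ) ≤
      ENNReal.ofReal u * h u ^ (2:ℝ) + ∫⁻ v in Ioi u, h v ^ (2:ℝ) := by
    refine le_trans (le_of_eq (lintegral_congr fun x => ?_)) (lintegral_small_le hf hupos)
    by_cases hx : ‖f x‖ₑ ≤ h u <;> simp [hf₂, indicator, hx, ← hh]
  have hlow : ENNReal.ofReal u * h u ≤ ∫⁻ v in Ioo 0 u, h v := by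
    calc ENNReal.ofReal u * h u = ∫⁻ v in Ioo 0 u, h u := by simp [mul_comm]
      _ ≤ _ := setLIntegral_mono' measurableSet_Ioo fun v hv =>
          rearrangement_antitone hv.2.le
  have hscale : ENNReal.ofReal (s ^ (-(1/2) : ℝ)) * ENNReal.ofReal u ^ (1/2 : ℝ) =
      ENNReal.ofReal A * ENNReal.ofReal u := by
    rw [ENNReal.ofReal_rpow_of_nonneg hupos.le (by norm_num), ← ENNReal.ofReal_mul (by positivity),
      ← ENNReal.ofReal_mul (by positivity)]
    congr 1
    have h1 : u ^ (1/2:ℝ) = A⁻¹ * s ^ (-(1/2):ℝ) := by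
      rw [hu, one_div, Real.inv_rpow (by positivity), Real.mul_rpow (by positivity) hs.le,
        ← Real.sqrt_eq_rpow, Real.sqrt_sq hApos.le, mul_inv, Real.rpow_neg hs.le]
    have h2 : s ^ (-(1/2):ℝ) * s ^ (-(1/2):ℝ) = s⁻¹ := by
      rw [← Real.rpow_add hs, ← Real.rpow_neg_one]
      norm_num
    calc s ^ (-(1/2):ℝ) * u ^ (1/2:ℝ) = A⁻¹ * (s ^ (-(1/2):ℝ) * s ^ (-(1/2):ℝ)) := by
          rw [h1]; ring
      _ = A * u := by
          rw [h2, hu]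
          field_simp
  have hsqrt : (∫⁻ x, ‖f₂ x‖ₑ ^ (2:ℝ)) ^ (1/2 : ℝ) ≤
      ENNReal.ofReal u ^ (1/2 : ℝ) * h u + (∫⁻ v in Ioi u, h v ^ (2:ℝ)) ^ (1/2 : ℝ) := by
    refine (ENNReal.rpow_le_rpow hL2 (by norm_num)).trans ?_
    refine (ENNReal.rpow_add_le_add_rpow _ _ (by norm_num) (by norm_num)).trans ?_
    rw [ENNReal.mul_rpow_of_nonneg _ _ (by norm_num), ← ENNReal.rpow_mul]
    norm_num
  have hE0 : volume E ≠ 0 := fun h0 => by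
    rw [h0, nonpos_iff_eq_zero, ENNReal.ofReal_eq_zero] at hsE
    exact absurd hs (not_lt.2 hsE)
  have hmE : volume E ^ (1/2 : ℝ) ≤ volume E * ENNReal.ofReal (s ^ (-(1/2) : ℝ)) := by
    calc volume E ^ (1/2 : ℝ) = volume E * volume E ^ (-(1/2) : ℝ) := by
          nth_rewrite 2 [← ENNReal.rpow_one (volume E)]
          rw [← ENNReal.rpow_add _ _ hE0 hE]
          norm_num
      _ ≤ _ := by
          rw [← ENNReal.ofReal_rpow_of_pos hs, ENNReal.rpow_neg, ENNReal.rpow_neg]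
          gcongr
  calc ∫⁻ x in E, ‖schrodinger n t f x‖ₑ
      ≤ ∫⁻ x in E, (‖schrodinger n t f₁ x‖ₑ + ‖schrodinger n t f₂ x‖ₑ) := by
        refine lintegral_mono fun x => ?_
        rw [hadd, schrodinger_add hint₁ hint₂]
        exact enorm_add_le _ _
    _ = (∫⁻ x in E, ‖schrodinger n t f₁ x‖ₑ) + ∫⁻ x in E, ‖schrodinger n t f₂ x‖ₑ :=
        lintegral_add_left (measurable_schrodinger t hf₁m).enorm _
    _ ≤ volume E * (ENNReal.ofReal A * ∫⁻ v in Ioo 0 u, h v) +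
        volume E * (ENNReal.ofReal (s ^ (-(1/2) : ℝ)) * (ENNReal.ofReal u ^ (1/2 : ℝ) * h u +
          (∫⁻ v in Ioi u, h v ^ (2:ℝ)) ^ (1/2 : ℝ))) := by
        refine add_le_add ?_ ?_
        · calc _ ≤ ∫⁻ x in E, ENNReal.ofReal A * ∫⁻ v in Ioo 0 u, h v := by
                refine lintegral_mono fun x => (enorm_schrodinger_le ht f₁ x).trans ?_
                gcongr
            _ = _ := by simp [mul_comm]
        · calc _ ≤ volume E ^ (1/2 : ℝ) *
                (∫⁻ x, ‖schrodinger n t f₂ x‖ₑ ^ (2:ℝ)) ^ (1/2 : ℝ) :=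
                setLIntegral_le_sqrt_measure_mul E (measurable_schrodinger t hf₂m).enorm
            _ ≤ (volume E * ENNReal.ofReal (s ^ (-(1/2) : ℝ))) *
                (∫⁻ x, ‖f₂ x‖ₑ ^ (2:ℝ)) ^ (1/2 : ℝ) := by
                exact mul_le_mul' hmE (ENNReal.rpow_le_rpow
                  (lintegral_sq_schrodinger_le ht hf₂m) (by norm_num))
            _ ≤ _ := by
                rw [mul_assoc]
                gcongr
    _ = volume E * ((ENNReal.ofReal A * ∫⁻ v in Ioo 0 u, h v) +
          ENNReal.ofReal A * (ENNReal.ofReal u * h u) +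
          ENNReal.ofReal (s ^ (-(1/2) : ℝ)) * (∫⁻ v in Ioi u, h v ^ (2:ℝ)) ^ (1/2 : ℝ)) := by
        rw [← mul_add, mul_add (ENNReal.ofReal (s ^ (-(1/2) : ℝ))), ← mul_assoc _ _ (h u), hscale]
        ring
    _ ≤ volume E * ((ENNReal.ofReal A * ∫⁻ v in Ioo 0 u, h v) +
          ENNReal.ofReal A * (∫⁻ v in Ioo 0 u, h v) +
          ENNReal.ofReal (s ^ (-(1/2) : ℝ)) * (∫⁻ v in Ioi u, h v ^ (2:ℝ)) ^ (1/2 : ℝ)) := by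
        gcongr
    _ = _ := by
        rw [couplingBound, ← two_mul, ← mul_assoc]

end DispersiveEstimate

section WeightedIntegrals

lemma lintegral_Ioo_rpow {r c : ℝ} (hr : 0 < r) (hc : 0 < c) :
    ∫⁻ s in Ioo 0 c, ENNReal.ofReal (s ^ (r - 1)) = ENNReal.ofReal (c ^ r / r) := by
  rw [Measure.restrict_congr_set Ioo_ae_eq_Ioc]
  have hi : IntegrableOn (fun s : ℝ => s ^ (r - 1)) (Ioc 0 c) :=
    (intervalIntegrable_iff_integrableOn_Ioc_of_le hc.le).1
      (intervalIntegral.intervalIntegrable_rpow' (by linarith))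
  rw [← ofReal_integral_eq_lintegral_ofReal hi
    (ae_restrict_of_forall_mem measurableSet_Ioc fun s hs => Real.rpow_nonneg hs.1.le _),
    ← intervalIntegral.integral_of_le hc.le, integral_rpow (Or.inl (by linarith))]
  simp [hr.ne']

lemma lintegral_Ioi_rpow {r c : ℝ} (hr : 0 < r) (hc : 0 < c) :
    ∫⁻ s in Ioi c, ENNReal.ofReal (s ^ (-r - 1)) = ENNReal.ofReal (c ^ (-r) / r) := by
  have hi : IntegrableOn (fun s : ℝ => s ^ (-r - 1)) (Ioi c) :=
    integrableOn_Ioi_rpow_of_lt (by linarith) hc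
  rw [← ofReal_integral_eq_lintegral_ofReal hi
    (ae_restrict_of_forall_mem measurableSet_Ioi fun s hs =>
      Real.rpow_nonneg (hc.trans hs).le _),
    integral_Ioi_rpow_of_lt (by linarith) hc]
  congr 1
  rw [sub_add_cancel, neg_div_neg_eq]

/-- Tonelli's theorem over a region of the quadrant described by its sections. -/
lemma setLIntegral_section_swap {S V : ℝ → Set ℝ} {D : Set (ℝ × ℝ)} (hD : MeasurableSet D)
    (hV : ∀ s ∈ Ioi (0:ℝ), V s = {v | v ∈ Ioi (0:ℝ) ∧ (s, v) ∈ D})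
    (hS : ∀ v ∈ Ioi (0:ℝ), S v = {s | s ∈ Ioi (0:ℝ) ∧ (s, v) ∈ D})
    {a b : ℝ → ℝ≥0∞} (ha : Measurable a) (hb : Measurable b) :
    ∫⁻ s in Ioi (0:ℝ), a s * ∫⁻ v in V s, b v = ∫⁻ v in Ioi (0:ℝ), b v * ∫⁻ s in S v, a s := by
  have hm : Measurable (D.indicator fun q : ℝ × ℝ => a q.1 * b q.2) :=
    (by fun_prop : Measurable fun q : ℝ × ℝ => a q.1 * b q.2).indicator hD
  calc ∫⁻ s in Ioi (0:ℝ), a s * ∫⁻ v in V s, b v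
      = ∫⁻ s in Ioi (0:ℝ), (∫⁻ v in Ioi (0:ℝ),
          (D.indicator fun q : ℝ × ℝ => a q.1 * b q.2) (s, v)) := by
        refine setLIntegral_congr_fun measurableSet_Ioi fun s hs => ?_
        have hms : MeasurableSet {v | (s, v) ∈ D} := measurable_prodMk_left hD
        have h1 : V s = {v | (s, v) ∈ D} ∩ Ioi 0 := by
          rw [hV s hs]; ext v; simp [and_comm]
        have h2 : (fun v => (D.indicator fun q : ℝ × ℝ => a q.1 * b q.2) (s, v)) =
            {v | (s, v) ∈ D}.indicator fun v => a s * b v := by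
          ext v; simp [indicator]
        rw [h2, lintegral_indicator hms, Measure.restrict_restrict hms, h1,
          lintegral_const_mul _ hb]
    _ = ∫⁻ v in Ioi (0:ℝ), (∫⁻ s in Ioi (0:ℝ),
          (D.indicator fun q : ℝ × ℝ => a q.1 * b q.2) (s, v)) :=
        lintegral_lintegral_swap hm.aemeasurable
    _ = _ := by
        refine setLIntegral_congr_fun measurableSet_Ioi fun v hv => ?_
        have hms : MeasurableSet {s | (s, v) ∈ D} := measurable_prodMk_right hD
        have h1 : S v = {s | (s, v) ∈ D} ∩ Ioi 0 := by
          rw [hS v hv]; ext s; simp [and_comm]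
        have h2 : (fun s => (D.indicator fun q : ℝ × ℝ => a q.1 * b q.2) (s, v)) =
            {s | (s, v) ∈ D}.indicator fun s => b v * a s := by
          ext s; simp [indicator, mul_comm]
        rw [h2, lintegral_indicator hms, Measure.restrict_restrict hms, h1,
          lintegral_const_mul _ ha]

lemma sq_setLIntegral_Ioo_le {β u : ℝ} (hβ : β < 1) (hu : 0 < u) {h : ℝ → ℝ≥0∞}
    (hh : Measurable h) :
    (∫⁻ v in Ioo 0 u, h v) ^ (2:ℝ) ≤ ENNReal.ofReal (u ^ (1 - β) / (1 - β)) *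
      ∫⁻ v in Ioo 0 u, ENNReal.ofReal (v ^ β) * h v ^ (2:ℝ) := by
  have hcs := ENNReal.lintegral_mul_le_Lp_mul_Lq (volume.restrict (Ioo 0 u)) (p := 2) (q := 2)
    ⟨by norm_num, by norm_num, by norm_num⟩
    (f := fun v => ENNReal.ofReal (v ^ (-β / 2)))
    (g := fun v => ENNReal.ofReal (v ^ (β / 2)) * h v) (by fun_prop) (by fun_prop)
  have h0 : ∫⁻ v in Ioo 0 u, h v = ∫⁻ v in Ioo 0 u,
      ((fun v => ENNReal.ofReal (v ^ (-β / 2))) * fun v => ENNReal.ofReal (v ^ (β / 2)) * h v) v := by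
    refine setLIntegral_congr_fun measurableSet_Ioo fun v hv => ?_
    simp only [Pi.mul_apply]
    rw [← mul_assoc, ← ENNReal.ofReal_mul (Real.rpow_nonneg hv.1.le _), ← Real.rpow_add hv.1,
      show -β / 2 + β / 2 = 0 by ring, Real.rpow_zero, ENNReal.ofReal_one, one_mul]
  have h1 : ∫⁻ v in Ioo 0 u, ENNReal.ofReal (v ^ (-β / 2)) ^ (2:ℝ) =
      ENNReal.ofReal (u ^ (1 - β) / (1 - β)) := by
    rw [← lintegral_Ioo_rpow (by linarith) hu]
    refine setLIntegral_congr_fun measurableSet_Ioo fun v hv => ?_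
    rw [ENNReal.ofReal_rpow_of_nonneg (Real.rpow_nonneg hv.1.le _) (by norm_num),
      ← Real.rpow_mul hv.1.le]
    congr 2
    ring
  have h2 : ∫⁻ v in Ioo 0 u, (ENNReal.ofReal (v ^ (β / 2)) * h v) ^ (2:ℝ) =
      ∫⁻ v in Ioo 0 u, ENNReal.ofReal (v ^ β) * h v ^ (2:ℝ) := by
    refine setLIntegral_congr_fun measurableSet_Ioo fun v hv => ?_
    rw [ENNReal.mul_rpow_of_nonneg _ _ (by norm_num),
      ENNReal.ofReal_rpow_of_nonneg (Real.rpow_nonneg hv.1.le _) (by norm_num),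
      ← Real.rpow_mul hv.1.le]
    congr 3
    ring
  rw [← h0, h1, h2] at hcs
  refine (ENNReal.rpow_le_rpow hcs (by norm_num : (0:ℝ) ≤ 2)).trans (le_of_eq ?_)
  rw [ENNReal.mul_rpow_of_nonneg _ _ (by norm_num), ← ENNReal.rpow_mul, ← ENNReal.rpow_mul]
  norm_num

lemma lt_one_div_mul_comm {K s v : ℝ} (hs : 0 < s) (hv : 0 < v) (hK : 0 < K) :
    v < 1 / (K * s) ↔ s < 1 / (K * v) := by
  rw [lt_div_iff₀ (by positivity), lt_div_iff₀ (by positivity)]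
  constructor <;> intro h <;> linarith [mul_comm v (K * s), mul_comm s (K * v),
    mul_assoc K s v, mul_assoc K v s, mul_comm s v]

lemma one_div_mul_lt_comm {K s v : ℝ} (hs : 0 < s) (hv : 0 < v) (hK : 0 < K) :
    1 / (K * s) < v ↔ 1 / (K * v) < s := by
  rw [div_lt_iff₀ (by positivity), div_lt_iff₀ (by positivity)]
  constructor <;> intro h <;> linarith [mul_comm v (K * s), mul_comm s (K * v),
    mul_assoc K s v, mul_assoc K v s, mul_comm s v]

lemma lintegral_Ioi_weight_mul_sq_Ioo_le {A α : ℝ} (hA : 0 < A) (hα : 0 < α)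
    {h : ℝ → ℝ≥0∞} (hh : Measurable h) :
    ∫⁻ s in Ioi (0:ℝ), ENNReal.ofReal (s ^ (α - 1)) *
        (ENNReal.ofReal A * ∫⁻ v in Ioo 0 (1 / (A ^ 2 * s)), h v) ^ (2:ℝ) ≤
      ENNReal.ofReal (4 / α ^ 2 * A ^ (2 * (1 - α))) *
        ∫⁻ v in Ioi (0:ℝ), ENNReal.ofReal (v ^ (1 - α)) * h v ^ (2:ℝ) := by
  have hK : 0 < A ^ 2 := by positivity
  set c := ENNReal.ofReal (2 / α * A ^ (2 - α)) with hc
  calc _ ≤ ∫⁻ s in Ioi (0:ℝ), c * (ENNReal.ofReal (s ^ (α / 2 - 1)) *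
          ∫⁻ v in Ioo 0 (1 / (A ^ 2 * s)), ENNReal.ofReal (v ^ (1 - α / 2)) * h v ^ (2:ℝ)) := by
        refine setLIntegral_mono' measurableSet_Ioi fun s (hs : 0 < s) => ?_
        have hu : 0 < 1 / (A ^ 2 * s) := by positivity
        rw [ENNReal.mul_rpow_of_nonneg _ _ (by norm_num : (0:ℝ) ≤ 2),
          ENNReal.ofReal_rpow_of_pos hA]
        calc _ ≤ ENNReal.ofReal (s ^ (α - 1)) * (ENNReal.ofReal (A ^ (2:ℝ)) *
              (ENNReal.ofReal ((1 / (A ^ 2 * s)) ^ (1 - (1 - α / 2)) / (1 - (1 - α / 2))) *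
                ∫⁻ v in Ioo 0 (1 / (A ^ 2 * s)),
                  ENNReal.ofReal (v ^ (1 - α / 2)) * h v ^ (2:ℝ))) := by
              gcongr
              exact sq_setLIntegral_Ioo_le (by linarith) hu hh
          _ = _ := by
              rw [← mul_assoc, ← mul_assoc, ← mul_assoc, hc,
                ← ENNReal.ofReal_mul (by positivity), ← ENNReal.ofReal_mul (by positivity),
                ← ENNReal.ofReal_mul (by positivity)]
              congr 2
              have e1 : (1 / (A ^ 2 * s)) ^ (1 - (1 - α / 2)) = A ^ (-α) * s ^ (-(α / 2)) := by
                rw [one_div, Real.inv_rpow (by positivity), Real.mul_rpow hK.le hs.le, mul_inv,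
                  ← Real.rpow_neg hs.le, ← Real.rpow_natCast, ← Real.rpow_mul hA.le,
                  ← Real.rpow_neg hA.le]
                congr 2 <;> push_cast <;> ring
              have e2 : A ^ (2 - α) = A ^ (2:ℝ) * A ^ (-α) := by
                rw [← Real.rpow_add hA]; congr 1
              have e3 : s ^ (α / 2 - 1) = s ^ (α - 1) * s ^ (-(α / 2)) := by
                rw [← Real.rpow_add hs]; congr 1; ring
              rw [e1, e2, e3, show (1 - (1 - α / 2) : ℝ) = α / 2 by ring]
              field_simp
    _ = c * ∫⁻ s in Ioi (0:ℝ), (ENNReal.ofReal (s ^ (α / 2 - 1)) *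
          ∫⁻ v in Ioo 0 (1 / (A ^ 2 * s)), ENNReal.ofReal (v ^ (1 - α / 2)) * h v ^ (2:ℝ)) :=
        lintegral_const_mul' _ _ ENNReal.ofReal_ne_top
    _ = c * ∫⁻ v in Ioi (0:ℝ), (ENNReal.ofReal (v ^ (1 - α / 2)) * h v ^ (2:ℝ)) *
          ∫⁻ s in Ioo 0 (1 / (A ^ 2 * v)), ENNReal.ofReal (s ^ (α / 2 - 1)) := by
        congr 1
        refine setLIntegral_section_swap (D := {q : ℝ × ℝ | q.2 < 1 / (A ^ 2 * q.1)})
          (measurableSet_lt (by fun_prop) (by fun_prop)) (fun s hs => rfl) (fun v hv => ?_)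
          (by fun_prop) (by fun_prop)
        ext s
        simp only [mem_Ioo, mem_ofPred_eq, mem_Ioi]
        exact and_congr_right fun hs => (lt_one_div_mul_comm hs hv hK).symm
    _ = c * ∫⁻ v in Ioi (0:ℝ), ENNReal.ofReal (2 / α * A ^ (-α)) *
          (ENNReal.ofReal (v ^ (1 - α)) * h v ^ (2:ℝ)) := by
        congr 1
        refine setLIntegral_congr_fun measurableSet_Ioi fun v (hv : 0 < v) => ?_
        have hu : 0 < 1 / (A ^ 2 * v) := by positivity
        rw [lintegral_Ioo_rpow (by positivity) hu, mul_right_comm,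
          ← ENNReal.ofReal_mul (by positivity), ← mul_assoc, ← ENNReal.ofReal_mul (by positivity)]
        congr 2
        have e1 : (1 / (A ^ 2 * v)) ^ (α / 2) = A ^ (-α) * v ^ (-(α / 2)) := by
          rw [one_div, Real.inv_rpow (by positivity), Real.mul_rpow hK.le hv.le, mul_inv,
            ← Real.rpow_neg hv.le, ← Real.rpow_natCast, ← Real.rpow_mul hA.le,
            ← Real.rpow_neg hA.le]
          congr 2; push_cast; ring
        have e3 : v ^ (1 - α) = v ^ (1 - α / 2) * v ^ (-(α / 2)) := by
          rw [← Real.rpow_add hv]; congr 1; ring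
        rw [e1, e3]
        field_simp
    _ = _ := by
        rw [lintegral_const_mul' _ _ ENNReal.ofReal_ne_top, ← mul_assoc, hc,
          ← ENNReal.ofReal_mul (by positivity)]
        congr 2
        have e2 : A ^ (2 * (1 - α)) = A ^ (2 - α) * A ^ (-α) := by
          rw [← Real.rpow_add hA]; congr 1; ring
        rw [e2]
        field_simp
        ring

lemma lintegral_Ioi_weight_mul_Ioi_le {A α : ℝ} (hA : 0 < A) (hα : α < 1)
    {h : ℝ → ℝ≥0∞} (hh : Measurable h) :
    ∫⁻ s in Ioi (0:ℝ), ENNReal.ofReal (s ^ (α - 1)) * (ENNReal.ofReal (s ^ (-(1/2) : ℝ)) *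
        (∫⁻ v in Ioi (1 / (A ^ 2 * s)), h v ^ (2:ℝ)) ^ (1/2 : ℝ)) ^ (2:ℝ) =
      ENNReal.ofReal (1 / (1 - α) * A ^ (2 * (1 - α))) *
        ∫⁻ v in Ioi (0:ℝ), ENNReal.ofReal (v ^ (1 - α)) * h v ^ (2:ℝ) := by
  have hK : 0 < A ^ 2 := by positivity
  have hα' : 0 < 1 - α := by linarith
  calc _ = ∫⁻ s in Ioi (0:ℝ), ENNReal.ofReal (s ^ (-(1 - α) - 1)) *
          ∫⁻ v in Ioi (1 / (A ^ 2 * s)), h v ^ (2:ℝ) := by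
        refine setLIntegral_congr_fun measurableSet_Ioi fun s (hs : 0 < s) => ?_
        rw [ENNReal.mul_rpow_of_nonneg _ _ (by norm_num : (0:ℝ) ≤ 2), ← ENNReal.rpow_mul,
          show (1/2:ℝ) * 2 = 1 by norm_num, ENNReal.rpow_one,
          ENNReal.ofReal_rpow_of_pos (by positivity), ← Real.rpow_mul hs.le, ← mul_assoc,
          ← ENNReal.ofReal_mul (by positivity), ← Real.rpow_add hs]
        congr 3
        ring
    _ = ∫⁻ v in Ioi (0:ℝ), h v ^ (2:ℝ) *
          ∫⁻ s in Ioi (1 / (A ^ 2 * v)), ENNReal.ofReal (s ^ (-(1 - α) - 1)) := by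
        refine setLIntegral_section_swap (D := {q : ℝ × ℝ | 1 / (A ^ 2 * q.1) < q.2})
          (measurableSet_lt (by fun_prop) (by fun_prop)) (fun s (hs : 0 < s) => ?_)
          (fun v (hv : 0 < v) => ?_) (by fun_prop) (by fun_prop)
        · ext v
          simp only [mem_ofPred_eq, mem_Ioi]
          have : 0 < 1 / (A ^ 2 * s) := by positivity
          exact ⟨fun h => ⟨this.trans h, h⟩, fun h => h.2⟩
        · ext s
          simp only [mem_ofPred_eq, mem_Ioi]
          have : 0 < 1 / (A ^ 2 * v) := by positivity
          exact ⟨fun h => ⟨this.trans h, (one_div_mul_lt_comm (this.trans h) hv hK).2 h⟩,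
            fun h => (one_div_mul_lt_comm h.1 hv hK).1 h.2⟩
    _ = ∫⁻ v in Ioi (0:ℝ), ENNReal.ofReal (1 / (1 - α) * A ^ (2 * (1 - α))) *
          (ENNReal.ofReal (v ^ (1 - α)) * h v ^ (2:ℝ)) := by
        refine setLIntegral_congr_fun measurableSet_Ioi fun v (hv : 0 < v) => ?_
        have hu : 0 < 1 / (A ^ 2 * v) := by positivity
        rw [lintegral_Ioi_rpow hα' hu, mul_comm, ← mul_assoc,
          ← ENNReal.ofReal_mul (by positivity)]
        congr 2
        rw [one_div, Real.inv_rpow (by positivity), ← Real.rpow_neg (by positivity), neg_neg,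
          Real.mul_rpow hK.le hv.le, ← Real.rpow_natCast, ← Real.rpow_mul hA.le]
        push_cast
        ring
    _ = _ := lintegral_const_mul' _ _ ENNReal.ofReal_ne_top

lemma lintegral_weight_mul_sq_couplingBound_le {A α : ℝ} (hA : 0 < A) (hα : 0 < α) (hα1 : α < 1)
    {h : ℝ → ℝ≥0∞} (hh : Measurable h) :
    ∫⁻ s in Ioi (0:ℝ), ENNReal.ofReal (s ^ (α - 1)) * couplingBound A h s ^ (2:ℝ) ≤
      ENNReal.ofReal ((32 / α ^ 2 + 2 / (1 - α)) * A ^ (2 * (1 - α))) *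
        ∫⁻ v in Ioi (0:ℝ), ENNReal.ofReal (v ^ (1 - α)) * h v ^ (2:ℝ) := by
  have hα' : 0 < 1 - α := by linarith
  set X : ℝ → ℝ≥0∞ := fun s => ENNReal.ofReal (s ^ (α - 1)) *
        (ENNReal.ofReal A * ∫⁻ v in Ioo 0 (1 / (A ^ 2 * s)), h v) ^ (2:ℝ) with hX
  set Y : ℝ → ℝ≥0∞ := fun s => ENNReal.ofReal (s ^ (α - 1)) * (ENNReal.ofReal (s ^ (-(1/2) : ℝ)) *
        (∫⁻ v in Ioi (1 / (A ^ 2 * s)), h v ^ (2:ℝ)) ^ (1/2 : ℝ)) ^ (2:ℝ) with hY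
  have hXm : Measurable X := by
    have h1 : Measurable fun s : ℝ => ∫⁻ v in Ioo 0 (1 / (A ^ 2 * s)), h v := by
      have hD : MeasurableSet {q : ℝ × ℝ | q.2 ∈ Ioo 0 (1 / (A ^ 2 * q.1))} :=
        (measurableSet_lt measurable_const measurable_snd).inter
          (measurableSet_lt measurable_snd
            (by fun_prop : Measurable fun q : ℝ × ℝ => 1 / (A ^ 2 * q.1)))
      have := ((hh.comp measurable_snd).indicator hD).lintegral_prod_right'
        (ν := (volume : Measure ℝ))
      convert this using 2 with s
      rw [← lintegral_indicator measurableSet_Ioo]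
      rfl
    exact (by fun_prop : Measurable fun s : ℝ => ENNReal.ofReal (s ^ (α - 1))).mul
      ((h1.const_mul _).pow_const _)
  calc _ ≤ ∫⁻ s in Ioi (0:ℝ), (8 * X s + 2 * Y s) := by
        refine lintegral_mono fun s => ?_
        have h1 := ENNReal.rpow_add_le_mul_rpow_add_rpow
          (2 * (ENNReal.ofReal A * ∫⁻ v in Ioo 0 (1 / (A ^ 2 * s)), h v))
          (ENNReal.ofReal (s ^ (-(1/2) : ℝ)) *
            (∫⁻ v in Ioi (1 / (A ^ 2 * s)), h v ^ (2:ℝ)) ^ (1/2 : ℝ)) (p := 2) (by norm_num)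
        rw [ENNReal.mul_rpow_of_nonneg 2 _ (by norm_num : (0:ℝ) ≤ 2),
          show (2:ℝ) - 1 = 1 by norm_num, ENNReal.rpow_one,
          show (2:ℝ≥0∞) ^ (2:ℝ) = 4 by rw [ENNReal.rpow_two]; norm_num] at h1
        rw [couplingBound, mul_assoc 2]
        refine (mul_le_mul_right h1 _).trans (le_of_eq ?_)
        simp only [hX, hY]
        ring
    _ = 8 * (∫⁻ s in Ioi (0:ℝ), X s) + 2 * ∫⁻ s in Ioi (0:ℝ), Y s := by
        rw [lintegral_add_left (hXm.const_mul _), lintegral_const_mul' _ _ (by simp),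
          lintegral_const_mul' _ _ (by simp)]
    _ ≤ 8 * (ENNReal.ofReal (4 / α ^ 2 * A ^ (2 * (1 - α))) *
          ∫⁻ v in Ioi (0:ℝ), ENNReal.ofReal (v ^ (1 - α)) * h v ^ (2:ℝ)) +
        2 * (ENNReal.ofReal (1 / (1 - α) * A ^ (2 * (1 - α))) *
          ∫⁻ v in Ioi (0:ℝ), ENNReal.ofReal (v ^ (1 - α)) * h v ^ (2:ℝ)) :=
        add_le_add (mul_le_mul_right (lintegral_Ioi_weight_mul_sq_Ioo_le hA hα hh) _)
          (mul_le_mul_right (lintegral_Ioi_weight_mul_Ioi_le hA hα1 hh).le _)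
    _ = _ := by
        rw [← mul_assoc, ← mul_assoc, ← add_mul, show (8:ℝ≥0∞) = ENNReal.ofReal 8 by simp,
          show (2:ℝ≥0∞) = ENNReal.ofReal 2 by simp, ← ENNReal.ofReal_mul (by norm_num),
          ← ENNReal.ofReal_mul (by norm_num), ← ENNReal.ofReal_add (by positivity) (by positivity)]
        congr 2
        ring

end WeightedIntegrals

section Minkowski

variable {α β : Type*} [MeasurableSpace α] [MeasurableSpace β]

lemma lintegral_mul_le_sqrt_mul_sqrt {μ : Measure α} {f g : α → ℝ≥0∞}
    (hf : Measurable f) (hg : Measurable g) :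
    ∫⁻ x, f x * g x ∂μ ≤ (∫⁻ x, f x ^ (2:ℝ) ∂μ) ^ (1/2 : ℝ) * (∫⁻ x, g x ^ (2:ℝ) ∂μ) ^ (1/2 : ℝ) :=
  ENNReal.lintegral_mul_le_Lp_mul_Lq μ ⟨by norm_num, by norm_num, by norm_num⟩
    hf.aemeasurable hg.aemeasurable

/-- Minkowski's integral inequality in `L²`. -/
lemma sqrt_lintegral_sq_lintegral_le {μ : Measure α} {ν : Measure β} [SFinite μ] [SFinite ν]
    {K : α → β → ℝ≥0∞} (hK : Measurable (Function.uncurry K)) :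
    (∫⁻ s, (∫⁻ τ, K s τ ∂ν) ^ (2:ℝ) ∂μ) ^ (1/2 : ℝ) ≤
      ∫⁻ τ, (∫⁻ s, K s τ ^ (2:ℝ) ∂μ) ^ (1/2 : ℝ) ∂ν := by
  have hs : ∀ s, Measurable (K s) := fun s => hK.comp measurable_prodMk_left
  have hτ : ∀ τ, Measurable fun s => K s τ := fun τ => hK.comp measurable_prodMk_right
  have h3 : Measurable fun q : (α × β) × β => K q.1.1 q.1.2 * K q.1.1 q.2 :=
    (hK.comp measurable_fst).mul (hK.comp ((measurable_fst.comp measurable_fst).prodMk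
      measurable_snd))
  have hN : Measurable fun τ => (∫⁻ s, K s τ ^ (2:ℝ) ∂μ) ^ (1/2 : ℝ) :=
    ((hK.pow_const (2:ℝ)).lintegral_prod_left' (μ := μ)).pow_const _
  have key : ∫⁻ s, (∫⁻ τ, K s τ ∂ν) ^ (2:ℝ) ∂μ ≤
      (∫⁻ τ, (∫⁻ s, K s τ ^ (2:ℝ) ∂μ) ^ (1/2 : ℝ) ∂ν) ^ (2:ℝ) := by
    calc ∫⁻ s, (∫⁻ τ, K s τ ∂ν) ^ (2:ℝ) ∂μ
        = ∫⁻ s, (∫⁻ τ, (∫⁻ τ', K s τ * K s τ' ∂ν) ∂ν) ∂μ := by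
          refine lintegral_congr fun s => ?_
          rw [ENNReal.rpow_two, sq, ← lintegral_mul_const _ (hs s)]
          exact lintegral_congr fun τ => (lintegral_const_mul _ (hs s)).symm
      _ = ∫⁻ τ, (∫⁻ s, (∫⁻ τ', K s τ * K s τ' ∂ν) ∂μ) ∂ν :=
          lintegral_lintegral_swap (h3.lintegral_prod_right' (ν := ν)).aemeasurable
      _ = ∫⁻ τ, (∫⁻ τ', (∫⁻ s, K s τ * K s τ' ∂μ) ∂ν) ∂ν := by
          refine lintegral_congr fun τ => lintegral_lintegral_swap ?_
          exact (((hτ τ).comp measurable_fst).mul hK).aemeasurable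
      _ ≤ ∫⁻ τ, (∫⁻ τ', (∫⁻ s, K s τ ^ (2:ℝ) ∂μ) ^ (1/2 : ℝ) *
            (∫⁻ s, K s τ' ^ (2:ℝ) ∂μ) ^ (1/2 : ℝ) ∂ν) ∂ν :=
          lintegral_mono fun τ => lintegral_mono fun τ' =>
            lintegral_mul_le_sqrt_mul_sqrt (hτ τ) (hτ τ')
      _ = _ := by
          rw [ENNReal.rpow_two, sq, ← lintegral_mul_const _ hN]
          exact lintegral_congr fun τ => lintegral_const_mul _ hN
  refine (ENNReal.rpow_le_rpow key (by norm_num : (0:ℝ) ≤ 1/2)).trans (le_of_eq ?_)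
  rw [← ENNReal.rpow_mul]
  norm_num

end Minkowski

section FractionalIntegration

lemma lintegral_comp_abs {φ : ℝ → ℝ≥0∞} (hφ : Measurable φ) :
    ∫⁻ u, φ |u| = 2 * ∫⁻ u in Ioi 0, φ u := by
  have h1 : ∫⁻ u in Iio 0, φ |u| = ∫⁻ u in Ioi 0, φ u := by
    have h := (Measure.measurePreserving_neg (volume : Measure ℝ)).setLIntegral_comp_preimage
      (s := Ioi 0) measurableSet_Ioi hφ
    rw [← h, show (Neg.neg ⁻¹' Ioi (0:ℝ)) = Iio 0 by ext; simp]
    refine setLIntegral_congr_fun measurableSet_Iio fun u (hu : u < 0) => ?_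
    rw [abs_of_neg hu]
  have h2 : ∫⁻ u in Ioi 0, φ |u| = ∫⁻ u in Ioi 0, φ u :=
    setLIntegral_congr_fun measurableSet_Ioi fun u (hu : 0 < u) => by rw [abs_of_pos hu]
  rw [← lintegral_add_compl _ measurableSet_Ioi (A := Ioi (0:ℝ)), compl_Ioi,
    ← Measure.restrict_congr_set Iio_ae_eq_Iic, h1, h2, two_mul]

lemma lintegral_comp_abs_sub {φ : ℝ → ℝ≥0∞} (hφ : Measurable φ) (t : ℝ) :
    ∫⁻ τ, φ |t - τ| = 2 * ∫⁻ u in Ioi 0, φ u := by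
  rw [lintegral_sub_left_eq_self (fun u => φ |u|) t, lintegral_comp_abs hφ]

lemma lintegral_min_mul_riesz_le {a : ℝ} (ha : 0 < a) (ha1 : a < 1) {g : ℝ → ℝ≥0∞}
    (hg : Measurable g) (hg1 : ∫⁻ τ, g τ ^ (2 / (2 - a)) ≤ 1) {M : ℝ} (hM : 0 < M) (t : ℝ) :
    ∫⁻ τ, min (g τ) (ENNReal.ofReal M) * ENNReal.ofReal (|t - τ| ^ (-a)) ≤
      ENNReal.ofReal (2 / (1 - a) + 2) * ENNReal.ofReal (M ^ (2 / (2 - a) - 1)) := by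
  have h1a : 0 < 1 - a := by linarith
  have h2a : 0 < 2 - a := by linarith
  set q := 2 / (2 - a) with hq
  set r := M ^ (-q) with hr
  have hr0 : 0 < r := by positivity
  set near : ℝ → ℝ≥0∞ := (Iio r).indicator fun x => ENNReal.ofReal (x ^ (-a)) with hnear
  set far : ℝ → ℝ≥0∞ := (Ici r).indicator fun x => ENNReal.ofReal (x ^ (-a)) with hfar
  have hnm : Measurable near :=
    (by fun_prop : Measurable fun x : ℝ => ENNReal.ofReal (x ^ (-a))).indicator measurableSet_Iio
  have hfm : Measurable far :=
    (by fun_prop : Measurable fun x : ℝ => ENNReal.ofReal (x ^ (-a))).indicator measurableSet_Ici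
  have habs : Measurable fun τ : ℝ => |t - τ| := by fun_prop
  have hN : ∫⁻ τ, near |t - τ| = ENNReal.ofReal (2 / (1 - a) * r ^ (1 - a)) := by
    rw [lintegral_comp_abs_sub hnm, hnear, lintegral_indicator measurableSet_Iio,
      Measure.restrict_restrict measurableSet_Iio, Iio_inter_Ioi,
      show -a = (1 - a) - 1 by ring, lintegral_Ioo_rpow h1a hr0,
      show (2:ℝ≥0∞) = ENNReal.ofReal 2 by simp, ← ENNReal.ofReal_mul (by norm_num)]
    congr 1
    ring
  have hF : ∫⁻ τ, far |t - τ| ^ (2 / a) = ENNReal.ofReal (2 * r⁻¹) := by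
    have h0 : ∀ x, far x ^ (2 / a) =
        (Ici r).indicator (fun x => ENNReal.ofReal (x ^ (-1 - 1 : ℝ))) x := by
      intro x
      by_cases hx : x ∈ Ici r
      · have hx0 : 0 < x := hr0.trans_le hx
        rw [hfar, indicator_of_mem hx, indicator_of_mem hx,
          ENNReal.ofReal_rpow_of_pos (by positivity), ← Real.rpow_mul hx0.le]
        congr 2
        field_simp
        norm_num
      · rw [hfar, indicator_of_notMem hx, indicator_of_notMem hx, ENNReal.zero_rpow_of_pos
          (by positivity)]
    simp_rw [h0]
    rw [lintegral_comp_abs_sub ((by fun_prop : Measurable fun x : ℝ =>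
        ENNReal.ofReal (x ^ (-1 - 1 : ℝ))).indicator measurableSet_Ici),
      lintegral_indicator measurableSet_Ici,
      Measure.restrict_restrict measurableSet_Ici,
      inter_eq_left.2 (show Ici r ⊆ Ioi 0 from fun x hx => hr0.trans_le hx),
      ← Measure.restrict_congr_set Ioi_ae_eq_Ici, lintegral_Ioi_rpow one_pos hr0,
      show (2:ℝ≥0∞) = ENNReal.ofReal 2 by simp, ← ENNReal.ofReal_mul (by norm_num),
      Real.rpow_neg_one, div_one]
  have hconj : q.HolderConjugate (2 / a) := by
    refine ⟨?_, by positivity, by positivity⟩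
    rw [hq]
    field_simp
    ring
  have hH : ∫⁻ τ, g τ * far |t - τ| ≤ ENNReal.ofReal (2 * r ^ (-(a / 2))) := by
    calc _ ≤ (∫⁻ τ, g τ ^ q) ^ (1 / q) * (∫⁻ τ, far |t - τ| ^ (2 / a)) ^ (1 / (2 / a)) :=
          ENNReal.lintegral_mul_le_Lp_mul_Lq volume hconj hg.aemeasurable
            (hfm.comp habs).aemeasurable
      _ ≤ 1 * ENNReal.ofReal (2 * r⁻¹) ^ (1 / (2 / a)) := by
          rw [hF]
          gcongr
          exact ENNReal.rpow_le_one hg1 (by positivity)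
      _ ≤ _ := by
          rw [one_mul, ENNReal.ofReal_rpow_of_pos (by positivity)]
          refine ENNReal.ofReal_le_ofReal ?_
          rw [Real.mul_rpow (by norm_num) (by positivity), Real.rpow_neg hr0.le,
            Real.inv_rpow hr0.le, one_div_div]
          gcongr
          calc (2:ℝ) ^ (a / 2) ≤ 2 ^ (1:ℝ) :=
                Real.rpow_le_rpow_of_exponent_le (by norm_num) (by linarith)
            _ = 2 := Real.rpow_one 2
  have e1 : M * r ^ (1 - a) = M ^ (q - 1) := by
    rw [hr, ← Real.rpow_mul hM.le]
    nth_rewrite 1 [← Real.rpow_one M]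
    rw [← Real.rpow_add hM]
    congr 1
    rw [hq]
    field_simp
    ring
  have e2 : r ^ (-(a / 2)) = M ^ (q - 1) := by
    rw [hr, ← Real.rpow_mul hM.le]
    congr 1
    rw [hq]
    field_simp
    ring
  calc _ ≤ ∫⁻ τ, (ENNReal.ofReal M * near |t - τ| + g τ * far |t - τ|) := by
        refine lintegral_mono fun τ => ?_
        by_cases hx : |t - τ| < r
        · rw [hnear, indicator_of_mem (show |t - τ| ∈ Iio r from hx)]
          exact le_add_right (by gcongr; exact min_le_right _ _)
        · rw [hfar, indicator_of_mem (show |t - τ| ∈ Ici r from not_lt.1 hx)]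
          exact le_add_left (by gcongr; exact min_le_left _ _)
    _ = ENNReal.ofReal M * (∫⁻ τ, near |t - τ|) + ∫⁻ τ, g τ * far |t - τ| := by
        have hm : Measurable fun τ => near |t - τ| := hnm.comp habs
        rw [lintegral_add_left (hm.const_mul _), lintegral_const_mul _ hm]
    _ ≤ ENNReal.ofReal M * ENNReal.ofReal (2 / (1 - a) * r ^ (1 - a)) +
          ENNReal.ofReal (2 * r ^ (-(a / 2))) := by
        rw [hN]
        gcongr
    _ = _ := by
        rw [← ENNReal.ofReal_mul hM.le, ← ENNReal.ofReal_add (by positivity) (by positivity),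
          ← ENNReal.ofReal_mul (by positivity), e2,
          show M * (2 / (1 - a) * r ^ (1 - a)) = 2 / (1 - a) * (M * r ^ (1 - a)) by ring, e1]
        congr 1
        ring

lemma lintegral_lintegral_min_mul_riesz_le {a : ℝ} (ha : 0 < a) (ha1 : a < 1) {f g : ℝ → ℝ≥0∞}
    (hf : Measurable f) (hg : Measurable g) (hf1 : ∫⁻ τ, f τ ^ (2 / (2 - a)) ≤ 1)
    (hg1 : ∫⁻ τ, g τ ^ (2 / (2 - a)) ≤ 1) :
    ∫⁻ t, (∫⁻ τ, f t * min (g τ) (f t) * ENNReal.ofReal (|t - τ| ^ (-a))) ≤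
      ENNReal.ofReal (2 / (1 - a) + 2) := by
  have h2a : 0 < 2 - a := by linarith
  set q := 2 / (2 - a) with hq
  have hq0 : 0 < q := by positivity
  calc _ ≤ ∫⁻ t, ENNReal.ofReal (2 / (1 - a) + 2) * f t ^ q := by
        refine lintegral_mono_ae ?_
        filter_upwards [ae_lt_top (hf.pow_const q) (hf1.trans_lt ENNReal.one_lt_top).ne]
          with t ht
        have hft : f t ≠ ∞ := fun h => by simp [h, hq0] at ht
        rcases eq_or_ne (f t) 0 with h0 | h0
        · simp [h0]
        have hM : 0 < (f t).toReal := ENNReal.toReal_pos h0 hft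
        have key := lintegral_min_mul_riesz_le ha ha1 hg hg1 hM t
        rw [ENNReal.ofReal_toReal hft, ← ENNReal.ofReal_rpow_of_pos hM,
          ENNReal.ofReal_toReal hft] at key
        simp_rw [mul_assoc]
        rw [lintegral_const_mul _ (by fun_prop)]
        refine (mul_le_mul_right key (f t)).trans (le_of_eq ?_)
        rw [mul_left_comm, ENNReal.rpow_sub _ _ h0 hft, ENNReal.rpow_one,
          ENNReal.mul_div_cancel h0 hft]
    _ = ENNReal.ofReal (2 / (1 - a) + 2) * ∫⁻ t, f t ^ q :=
        lintegral_const_mul' _ _ ENNReal.ofReal_ne_top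
    _ ≤ _ := mul_le_of_le_one_right' hf1

lemma lintegral_lintegral_riesz_le {a : ℝ} (ha : 0 < a) (ha1 : a < 1) {f g : ℝ → ℝ≥0∞}
    (hf : Measurable f) (hg : Measurable g) (hf1 : ∫⁻ τ, f τ ^ (2 / (2 - a)) ≤ 1)
    (hg1 : ∫⁻ τ, g τ ^ (2 / (2 - a)) ≤ 1) :
    ∫⁻ t, f t * (∫⁻ τ, g τ * ENNReal.ofReal (|t - τ| ^ (-a))) ≤
      2 * ENNReal.ofReal (2 / (1 - a) + 2) := by
  have hm : Measurable fun z : ℝ × ℝ =>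
      f z.1 * min (g z.2) (f z.1) * ENNReal.ofReal (|z.1 - z.2| ^ (-a)) := by fun_prop
  have hm' : Measurable fun z : ℝ × ℝ =>
      g z.2 * min (f z.1) (g z.2) * ENNReal.ofReal (|z.2 - z.1| ^ (-a)) := by fun_prop
  calc _ ≤ ∫⁻ t, ((∫⁻ τ, f t * min (g τ) (f t) * ENNReal.ofReal (|t - τ| ^ (-a))) +
          ∫⁻ τ, g τ * min (f t) (g τ) * ENNReal.ofReal (|τ - t| ^ (-a))) := by
        refine lintegral_mono fun t => ?_
        rw [← lintegral_const_mul _ (by fun_prop), ← lintegral_add_left (by fun_prop)]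
        refine lintegral_mono fun τ => ?_
        rw [abs_sub_comm τ t, ← add_mul, ← mul_assoc]
        gcongr
        rcases le_total (f t) (g τ) with h | h
        · rw [min_eq_left h, mul_comm (g τ)]; exact le_add_self
        · rw [min_eq_left h]; exact le_self_add
    _ = (∫⁻ t, (∫⁻ τ, f t * min (g τ) (f t) * ENNReal.ofReal (|t - τ| ^ (-a)))) +
          ∫⁻ t, (∫⁻ τ, g τ * min (f t) (g τ) * ENNReal.ofReal (|τ - t| ^ (-a))) :=
        lintegral_add_left (hm.lintegral_prod_right' (ν := volume)) _
    _ = (∫⁻ t, (∫⁻ τ, f t * min (g τ) (f t) * ENNReal.ofReal (|t - τ| ^ (-a)))) +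
          ∫⁻ τ, (∫⁻ t, g τ * min (f t) (g τ) * ENNReal.ofReal (|τ - t| ^ (-a))) := by
        congr 1
        exact lintegral_lintegral_swap hm'.aemeasurable
    _ ≤ _ := by
        rw [two_mul]
        exact add_le_add (lintegral_lintegral_min_mul_riesz_le ha ha1 hf hg hf1 hg1)
          (lintegral_lintegral_min_mul_riesz_le ha ha1 hg hf hg1 hf1)

/-- A function whose pairing with the unit ball of `L^q` is bounded by `B` has conjugate norm at
most `B`. -/
lemma lintegral_rpow_le_of_forall_pairing_le {q r : ℝ} (hqr : q.HolderConjugate r) {B : ℝ≥0∞}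
    {u : ℝ → ℝ≥0∞} (hu : Measurable u)
    (h : ∀ f : ℝ → ℝ≥0∞, Measurable f → ∫⁻ t, f t ^ q ≤ 1 → ∫⁻ t, f t * u t ≤ B) :
    ∫⁻ t, u t ^ r ≤ B ^ r := by
  have hr0 : 0 < r := hqr.symm.pos
  have hq0 : 0 < q := hqr.pos
  have hr1 : 1 < r := hqr.symm.lt
  set F : ℕ → ℝ → ℝ≥0∞ := fun k => (Icc (-k : ℝ) k).indicator fun t => min (u t) k with hF
  have hFm : ∀ k, Measurable (F k) := fun k =>
    (hu.min measurable_const).indicator measurableSet_Icc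
  have hFu : ∀ k t, F k t ≤ u t := fun k t =>
    (indicator_le_self' (fun _ _ => zero_le) t).trans (min_le_left _ _)
  have hbound : ∀ k, ∫⁻ t, F k t ^ r ≤ B ^ r := by
    intro k
    set X := ∫⁻ t, F k t ^ r with hX
    have hXt : X ≠ ∞ := by
      have h1 : X ≤ ∫⁻ t in Icc (-k : ℝ) k, (k:ℝ≥0∞) ^ r := by
        rw [← lintegral_indicator measurableSet_Icc]
        refine lintegral_mono fun t => ?_
        by_cases ht : t ∈ Icc (-k : ℝ) k
        · rw [indicator_of_mem ht, hF]
          simp only [indicator_of_mem ht]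
          gcongr
          exact min_le_right _ _
        · rw [indicator_of_notMem ht, hF]
          simp only [indicator_of_notMem ht]
          rw [ENNReal.zero_rpow_of_pos hr0]
      refine (h1.trans_lt ?_).ne
      rw [setLIntegral_const, Real.volume_Icc]
      exact ENNReal.mul_lt_top (ENNReal.rpow_lt_top_of_nonneg hr0.le (by simp)) (by simp)
    rcases eq_or_ne X 0 with h0 | h0
    · rw [h0]; exact zero_le
    have hXq0 : X ^ (1 / q) ≠ 0 := by simp [h0, hXt]
    have hXqt : X ^ (1 / q) ≠ ∞ := ENNReal.rpow_ne_top_of_nonneg (by positivity) hXt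
    have hfq : ∫⁻ t, ((X ^ (1 / q))⁻¹ * F k t ^ (r - 1)) ^ q ≤ 1 := by
      have : ∀ t, ((X ^ (1 / q))⁻¹ * F k t ^ (r - 1)) ^ q = X⁻¹ * F k t ^ r := by
        intro t
        rw [ENNReal.mul_rpow_of_nonneg _ _ hq0.le, ENNReal.inv_rpow, ← ENNReal.rpow_mul,
          ← ENNReal.rpow_mul, one_div_mul_cancel hq0.ne', ENNReal.rpow_one,
          hqr.symm.sub_one_mul_conj]
      simp_rw [this]
      rw [lintegral_const_mul _ ((hFm k).pow_const _), ENNReal.inv_mul_cancel h0 hXt]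
    have key := h _ (((hFm k).pow_const (r - 1)).const_mul (X ^ (1 / q))⁻¹) hfq
    have h2 : (X ^ (1 / q))⁻¹ * X ≤ B := by
      refine le_trans ?_ key
      rw [hX, ← lintegral_const_mul _ ((hFm k).pow_const _)]
      refine lintegral_mono fun t => ?_
      rw [mul_assoc]
      gcongr
      calc F k t ^ r = F k t ^ (r - 1) * F k t := by
            nth_rewrite 3 [← ENNReal.rpow_one (F k t)]
            rw [← ENNReal.rpow_add_of_nonneg _ _ (by linarith) zero_le_one, sub_add_cancel]
        _ ≤ _ := by gcongr; exact hFu k t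
    have h3 : (X ^ (1 / q))⁻¹ * X = X ^ (1 / r) := by
      rw [← ENNReal.rpow_neg]
      nth_rewrite 2 [← ENNReal.rpow_one X]
      rw [← ENNReal.rpow_add _ _ h0 hXt]
      congr 1
      have := hqr.inv_add_inv_eq_one
      rw [one_div, one_div]
      linarith
    rw [h3] at h2
    calc X = (X ^ (1 / r)) ^ r := by
          rw [← ENNReal.rpow_mul, one_div_mul_cancel hr0.ne', ENNReal.rpow_one]
      _ ≤ _ := by gcongr
  have hlim : ∀ t, Tendsto (fun k => F k t ^ r) atTop (nhds (u t ^ r)) := by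
    intro t
    refine (ENNReal.continuous_rpow_const.tendsto _).comp ?_
    have h1 : Tendsto (fun k : ℕ => min (u t) (k:ℝ≥0∞)) atTop (nhds (u t)) := by
      have := (tendsto_const_nhds (x := u t)).min ENNReal.tendsto_nat_nhds_top
      rwa [min_eq_left le_top] at this
    refine h1.congr' ?_
    obtain ⟨N, hN⟩ := exists_nat_ge |t|
    filter_upwards [eventually_ge_atTop N] with k hk
    have : |t| ≤ k := hN.trans (by exact_mod_cast hk)
    rw [hF]
    simp only [indicator_of_mem (show t ∈ Icc (-k : ℝ) k from abs_le.1 this)]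
  calc ∫⁻ t, u t ^ r = ∫⁻ t, liminf (fun k => F k t ^ r) atTop :=
        lintegral_congr fun t => (hlim t).liminf_eq.symm
    _ ≤ liminf (fun k => ∫⁻ t, F k t ^ r) atTop :=
        lintegral_liminf_le fun k => (hFm k).pow_const _
    _ ≤ B ^ r := liminf_le_of_frequently_le' (Frequently.of_forall hbound)

/-- The one-dimensional Hardy–Littlewood–Sobolev inequality on the line of duality. -/
lemma lintegral_rpow_riesz_le {a : ℝ} (ha : 0 < a) (ha1 : a < 1) {g : ℝ → ℝ≥0∞}
    (hg : Measurable g) :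
    (∫⁻ t, (∫⁻ τ, g τ * ENNReal.ofReal (|t - τ| ^ (-a))) ^ (2 / a)) ^ (a / 2) ≤
      2 * ENNReal.ofReal (2 / (1 - a) + 2) * (∫⁻ τ, g τ ^ (2 / (2 - a))) ^ ((2 - a) / 2) := by
  have h2a : 0 < 2 - a := by linarith
  have h1a : 0 < 1 - a := by linarith
  set q := 2 / (2 - a) with hq
  have hq0 : 0 < q := by positivity
  have hq' : (2 - a) / 2 = 1 / q := by rw [hq, one_div_div]
  have hconj : q.HolderConjugate (2 / a) := by
    refine ⟨?_, by positivity, by positivity⟩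
    rw [hq]
    field_simp
    ring
  set c := 2 * ENNReal.ofReal (2 / (1 - a) + 2) with hc
  have hc0 : c ≠ 0 := by
    rw [hc]
    have : 0 < 2 / (1 - a) + 2 := by positivity
    simp [this]
  rw [hq']
  set G := (∫⁻ τ, g τ ^ q) ^ (1 / q) with hG
  have hm : ∀ g : ℝ → ℝ≥0∞, Measurable g →
      Measurable fun t => ∫⁻ τ, g τ * ENNReal.ofReal (|t - τ| ^ (-a)) := fun g hg =>
    (by fun_prop : Measurable fun z : ℝ × ℝ =>
      g z.2 * ENNReal.ofReal (|z.1 - z.2| ^ (-a))).lintegral_prod_right' (ν := volume)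
  rcases eq_or_ne G 0 with h0 | h0
  · have h1 : ∫⁻ τ, g τ ^ q = 0 := by
      rw [hG, ENNReal.rpow_eq_zero_iff_of_pos (by positivity)] at h0
      exact h0
    have h2 : g =ᵐ[volume] 0 := by
      rw [lintegral_eq_zero_iff (hg.pow_const q)] at h1
      filter_upwards [h1] with τ hτ
      simpa [ENNReal.rpow_eq_zero_iff_of_pos hq0] using hτ
    have h3 : ∀ t, ∫⁻ τ, g τ * ENNReal.ofReal (|t - τ| ^ (-a)) = 0 := by
      intro t
      rw [lintegral_congr_ae (g := fun _ => 0) (by filter_upwards [h2] with τ hτ; simp [hτ])]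
      simp
    simp_rw [h3]
    rw [ENNReal.zero_rpow_of_pos (by positivity)]
    simp [ha]
  rcases eq_or_ne G ∞ with ht | ht
  · rw [ht, ENNReal.mul_top hc0]; exact le_top
  have hg1 : ∫⁻ τ, (G⁻¹ * g τ) ^ q ≤ 1 := by
    simp_rw [ENNReal.mul_rpow_of_nonneg _ _ hq0.le]
    rw [lintegral_const_mul _ (hg.pow_const q)]
    have : ∫⁻ τ, g τ ^ q = G ^ q := by
      rw [hG, ← ENNReal.rpow_mul, one_div_mul_cancel hq0.ne', ENNReal.rpow_one]
    rw [this, ← ENNReal.mul_rpow_of_nonneg _ _ hq0.le, ENNReal.inv_mul_cancel h0 ht,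
      ENNReal.one_rpow]
  have key := lintegral_rpow_le_of_forall_pairing_le hconj (hm _ (hg.const_mul G⁻¹))
    fun f hf hf1 => lintegral_lintegral_riesz_le ha ha1 hf (hg.const_mul G⁻¹) hf1 hg1
  have hsc : ∀ t, ∫⁻ τ, g τ * ENNReal.ofReal (|t - τ| ^ (-a)) =
      G * ∫⁻ τ, G⁻¹ * g τ * ENNReal.ofReal (|t - τ| ^ (-a)) := by
    intro t
    rw [← lintegral_const_mul _ (by fun_prop)]
    refine lintegral_congr fun τ => ?_
    rw [← mul_assoc, ← mul_assoc, ENNReal.mul_inv_cancel h0 ht, one_mul]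
  simp_rw [hsc, ENNReal.mul_rpow_of_nonneg _ _ (show (0:ℝ) ≤ 2 / a by positivity)]
  rw [lintegral_const_mul _ ((hm _ (hg.const_mul G⁻¹)).pow_const _)]
  calc _ ≤ (G ^ (2 / a) * c ^ (2 / a)) ^ (a / 2) := by gcongr
    _ = c * G := by
      rw [← ENNReal.mul_rpow_of_nonneg _ _ (by positivity), ← ENNReal.rpow_mul,
        show 2 / a * (a / 2) = 1 by field_simp, ENNReal.rpow_one, mul_comm]

end FractionalIntegration

section Measurability

lemma measurable_schrodinger_section {n : ℕ} (t : ℝ) {f : ℝ → Rn n → ℂ}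
    (hf : Measurable fun q : ℝ × Rn n => f q.1 q.2) :
    Measurable fun q : ℝ × Rn n => schrodinger n (t - q.1) (f q.1) q.2 := by
  have h1 : Measurable fun z : (ℝ × Rn n) × Rn n =>
      schrodingerPhase n (t - z.1.1) z.1.2 z.2 * f z.1.1 z.2 :=
    ((measurable_schrodingerPhase n).comp
      (by fun_prop : Measurable fun z : (ℝ × Rn n) × Rn n => (t - z.1.1, z.1.2, z.2))).mul
      (hf.comp (by fun_prop : Measurable fun z : (ℝ × Rn n) × Rn n => (z.1.1, z.2)))
  have h2 : Measurable fun q : ℝ × Rn n =>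
      ∫ y, schrodingerPhase n (t - q.1) q.2 y * f q.1 y :=
    (h1.stronglyMeasurable.integral_prod_right (ν := volume)).measurable
  exact (by fun_prop : Measurable fun q : ℝ × Rn n =>
    (4 * (Real.pi : ℂ) * Complex.I * ((t - q.1 : ℝ) : ℂ)) ^ (-(n : ℂ) / 2)).mul h2

lemma measurable_rearrangement_section {n : ℕ} {f : ℝ → Rn n → ℂ}
    (hf : Measurable fun q : ℝ × Rn n => f q.1 q.2) :
    Measurable fun q : ℝ × ℝ => rearrangement volume (f q.1) q.2 := by
  refine measurable_of_Ioi fun l => ?_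
  have h1 : MeasurableSet {q : ℝ × Rn n | l < ‖f q.1 q.2‖ₑ} :=
    measurableSet_lt measurable_const hf.enorm
  have h2 : Measurable fun τ : ℝ => volume {x | l < ‖f τ x‖ₑ} := measurable_measure_prodMk_left h1
  have h3 : (fun q : ℝ × ℝ => rearrangement volume (f q.1) q.2) ⁻¹' Ioi l =
      {q | ENNReal.ofReal q.2 < volume {x | l < ‖f q.1 x‖ₑ}} := by
    ext q
    exact lt_rearrangement_iff l q.2
  rw [h3]
  exact measurableSet_lt (by fun_prop) (h2.comp measurable_fst)

lemma measurable_couplingBound {A : ℝ → ℝ} (hA : Measurable A) {h : ℝ → ℝ → ℝ≥0∞}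
    (hh : Measurable fun q : ℝ × ℝ => h q.1 q.2) :
    Measurable fun q : ℝ × ℝ => couplingBound (A q.2) (h q.2) q.1 := by
  have hθ : Measurable fun z : (ℝ × ℝ) × ℝ => 1 / (A z.1.2 ^ 2 * z.1.1) := by fun_prop
  have hh' : Measurable fun z : (ℝ × ℝ) × ℝ => h z.1.2 z.2 :=
    hh.comp (by fun_prop : Measurable fun z : (ℝ × ℝ) × ℝ => (z.1.2, z.2))
  have h1 : Measurable fun q : ℝ × ℝ => ∫⁻ v in Ioo 0 (1 / (A q.2 ^ 2 * q.1)), h q.2 v := by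
    have hD : MeasurableSet {z : (ℝ × ℝ) × ℝ | z.2 ∈ Ioo 0 (1 / (A z.1.2 ^ 2 * z.1.1))} :=
      (measurableSet_lt measurable_const measurable_snd).inter (measurableSet_lt measurable_snd hθ)
    have := (hh'.indicator hD).lintegral_prod_right' (ν := (volume : Measure ℝ))
    convert this using 2 with q
    rw [← lintegral_indicator measurableSet_Ioo]
    rfl
  have h2 : Measurable fun q : ℝ × ℝ =>
      ∫⁻ v in Ioi (1 / (A q.2 ^ 2 * q.1)), h q.2 v ^ (2:ℝ) := by
    have hD : MeasurableSet {z : (ℝ × ℝ) × ℝ | z.2 ∈ Ioi (1 / (A z.1.2 ^ 2 * z.1.1))} :=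
      measurableSet_lt hθ measurable_snd
    have := ((hh'.pow_const (2:ℝ)).indicator hD).lintegral_prod_right' (ν := (volume : Measure ℝ))
    convert this using 2 with q
    rw [← lintegral_indicator measurableSet_Ioi]
    rfl
  unfold couplingBound
  fun_prop

lemma lornorm_eq (n : ℕ) {p : ℝ} (hp : 0 < p) (g : Rn n → ℂ) :
    lornorm n p g = (∫⁻ s in Ioi (0:ℝ), ENNReal.ofReal (s ^ (2 / p - 1)) *
      rearrangement volume g s ^ (2:ℝ)) ^ (1/2 : ℝ) := by
  unfold lornorm lorentzNorm
  rw [if_neg (by simp), ENNReal.toReal_ofReal hp.le, ENNReal.toReal_ofNat, one_div]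
  congr 1
  refine setLIntegral_congr_fun measurableSet_Ioi fun s (hs : 0 < s) => ?_
  rw [ENNReal.mul_rpow_of_nonneg _ _ (by norm_num : (0:ℝ) ≤ 2),
    ENNReal.ofReal_rpow_of_pos (by positivity), ← Real.rpow_mul hs.le, mul_right_comm,
    ← ENNReal.ofReal_mul (by positivity), ← Real.rpow_neg_one s, ← Real.rpow_add hs]
  congr 3
  ring

lemma measurable_lornorm_section {n : ℕ} {p : ℝ} (hp : 0 < p) {f : ℝ → Rn n → ℂ}
    (hf : Measurable fun q : ℝ × Rn n => f q.1 q.2) :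
    Measurable fun τ => lornorm n p (f τ) := by
  simp_rw [lornorm_eq n hp]
  refine Measurable.pow_const ?_ _
  exact ((by fun_prop : Measurable fun q : ℝ × ℝ => ENNReal.ofReal (q.2 ^ (2 / p - 1))).mul
    ((measurable_rearrangement_section hf).pow_const _)).lintegral_prod_right'
      (ν := volume.restrict (Ioi 0))

lemma lornorm_two {n : ℕ} {g : Rn n → ℂ} (hg : Measurable g) :
    lornorm n 2 g = (∫⁻ x, ‖g x‖ₑ ^ (2:ℝ)) ^ (1/2 : ℝ) := by
  rw [lornorm_eq n two_pos, ← lintegral_sq_rearrangement hg]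
  simp

end Measurability

section Duhamel

lemma measurable_duhamel {n : ℕ} {f : ℝ → Rn n → ℂ}
    (hf : Measurable fun q : ℝ × Rn n => f q.1 q.2) {t : ℝ} (ht : 0 ≤ t) :
    Measurable (duhamel n 0 f t) := by
  unfold duhamel
  simp_rw [intervalIntegral.integral_of_le ht]
  exact ((measurable_schrodinger_section t hf).stronglyMeasurable.integral_prod_left'
    (μ := volume.restrict (Ioc 0 t))).measurable

lemma enorm_duhamel_le {n : ℕ} (f : ℝ → Rn n → ℂ) {t : ℝ} (ht : 0 ≤ t) (x : Rn n) :
    ‖duhamel n 0 f t x‖ₑ ≤ ∫⁻ τ in Ioo 0 t, ‖schrodinger n (t - τ) (f τ) x‖ₑ := by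
  unfold duhamel
  rw [intervalIntegral.integral_of_le ht, Measure.restrict_congr_set Ioo_ae_eq_Ioc]
  exact enorm_integral_le_lintegral_enorm _

lemma lornorm_two_duhamel_le {n : ℕ} {f : ℝ → Rn n → ℂ}
    (hf : Measurable fun q : ℝ × Rn n => f q.1 q.2) {t : ℝ} (ht : 0 ≤ t) :
    lornorm n 2 (duhamel n 0 f t) ≤ ∫⁻ τ in Ioo 0 t, lornorm n 2 (f τ) := by
  have hfτ : ∀ τ, Measurable (f τ) := fun τ => hf.comp measurable_prodMk_left
  rw [lornorm_two (measurable_duhamel hf ht)]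
  calc _ ≤ (∫⁻ x, (∫⁻ τ in Ioo 0 t, ‖schrodinger n (t - τ) (f τ) x‖ₑ) ^ (2:ℝ)) ^ (1/2 : ℝ) := by
        gcongr with x
        exact enorm_duhamel_le f ht x
    _ ≤ ∫⁻ τ in Ioo 0 t, (∫⁻ x, ‖schrodinger n (t - τ) (f τ) x‖ₑ ^ (2:ℝ)) ^ (1/2 : ℝ) :=
        sqrt_lintegral_sq_lintegral_le (K := fun x τ => ‖schrodinger n (t - τ) (f τ) x‖ₑ)
          ((measurable_schrodinger_section t hf).comp measurable_swap).enorm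
    _ ≤ _ := by
        refine setLIntegral_mono' measurableSet_Ioo fun τ hτ => ?_
        rw [lornorm_two (hfτ τ)]
        exact ENNReal.rpow_le_rpow (lintegral_sq_schrodinger_le (sub_pos.2 hτ.2) (hfτ τ))
          (by norm_num)

lemma rearrangement_duhamel_le {n : ℕ} {f : ℝ → Rn n → ℂ}
    (hf : Measurable fun q : ℝ × Rn n => f q.1 q.2) {t s : ℝ} (ht : 0 ≤ t) (hs : 0 < s) :
    rearrangement volume (duhamel n 0 f t) s ≤ ∫⁻ τ in Ioo 0 t,
      couplingBound ((4 * Real.pi * (t - τ)) ^ (-(n : ℝ) / 2)) (rearrangement volume (f τ)) s := by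
  set B := ∫⁻ τ in Ioo 0 t,
    couplingBound ((4 * Real.pi * (t - τ)) ^ (-(n : ℝ) / 2)) (rearrangement volume (f τ)) s with hB
  by_contra! hlt
  have hBt : B ≠ ∞ := hlt.ne_top
  have hdm := measurable_duhamel hf ht
  rw [lt_rearrangement_iff] at hlt
  obtain ⟨E, hEm, hEs, hE1, hE2⟩ := Measure.exists_subset_measure_lt_top
    (measurableSet_lt measurable_const hdm.enorm) hlt
  have hE0 : volume E ≠ 0 := (zero_le.trans_lt hE1).ne'
  have h1 : ∫⁻ _ in E, B < ∫⁻ x in E, ‖duhamel n 0 f t x‖ₑ := by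
    refine setLIntegral_strict_mono hEm hE0 hdm.enorm ?_ (Eventually.of_forall fun x hx => hEs hx)
    rw [setLIntegral_const]
    exact ENNReal.mul_ne_top hBt hE2.ne
  have h2 : ∫⁻ x in E, ‖duhamel n 0 f t x‖ₑ ≤ volume E * B := by
    calc _ ≤ ∫⁻ x in E, (∫⁻ τ in Ioo 0 t, ‖schrodinger n (t - τ) (f τ) x‖ₑ) :=
          lintegral_mono fun x => enorm_duhamel_le f ht x
      _ = ∫⁻ τ in Ioo 0 t, (∫⁻ x in E, ‖schrodinger n (t - τ) (f τ) x‖ₑ) :=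
          lintegral_lintegral_swap
            ((measurable_schrodinger_section t hf).comp measurable_swap).enorm.aemeasurable
      _ ≤ ∫⁻ τ in Ioo 0 t, volume E * couplingBound ((4 * Real.pi * (t - τ)) ^ (-(n : ℝ) / 2))
            (rearrangement volume (f τ)) s :=
          setLIntegral_mono' measurableSet_Ioo fun τ hτ =>
            setLIntegral_schrodinger_le (sub_pos.2 hτ.2) (hf.comp measurable_prodMk_left) hs
              hE1.le hE2.ne
      _ = _ := lintegral_const_mul' _ _ hE2.ne
  rw [setLIntegral_const, mul_comm] at h1
  exact absurd h2 (not_le.2 h1)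

lemma lornorm_duhamel_le {n : ℕ} {p : ℝ} (hp : 2 < p) {f : ℝ → Rn n → ℂ}
    (hf : Measurable fun q : ℝ × Rn n => f q.1 q.2) {t : ℝ} (ht : 0 ≤ t) :
    lornorm n p (duhamel n 0 f t) ≤
      ENNReal.ofReal (32 / (2 / p) ^ 2 + 2 / (1 - 2 / p)) ^ (1/2 : ℝ) *
        ∫⁻ τ in Ioo 0 t, lornorm n (p / (p - 1)) (f τ) *
          ENNReal.ofReal (|t - τ| ^ (-(n * (1/2 - 1/p)))) := by
  have hp0 : 0 < p := by linarith
  have hp1 : 0 < p - 1 := by linarith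
  set α := 2 / p with hα
  have hα0 : 0 < α := by positivity
  have hα1 : α < 1 := by rw [hα, div_lt_one hp0]; exact hp
  have hα1' : 0 < 1 - α := by linarith
  set A : ℝ → ℝ := fun τ => (4 * Real.pi * (t - τ)) ^ (-(n : ℝ) / 2) with hA
  have hAm : Measurable A := by fun_prop
  have hR := measurable_rearrangement_section hf
  have hK : Measurable fun q : ℝ × ℝ => ENNReal.ofReal (q.1 ^ (α - 1)) ^ (1/2 : ℝ) *
      couplingBound (A q.2) (rearrangement volume (f q.2)) q.1 :=
    (by fun_prop : Measurable fun q : ℝ × ℝ => ENNReal.ofReal (q.1 ^ (α - 1)) ^ (1/2 : ℝ)).mul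
      (measurable_couplingBound hAm (h := fun τ => rearrangement volume (f τ)) hR)
  have hsq : ∀ x y : ℝ≥0∞, (x ^ (1/2 : ℝ) * y) ^ (2:ℝ) = x * y ^ (2:ℝ) := fun x y => by
    rw [ENNReal.mul_rpow_of_nonneg _ _ (by norm_num : (0:ℝ) ≤ 2), ← ENNReal.rpow_mul]
    norm_num
  rw [lornorm_eq n hp0]
  calc _ ≤ (∫⁻ s in Ioi (0:ℝ), (∫⁻ τ in Ioo 0 t, ENNReal.ofReal (s ^ (α - 1)) ^ (1/2 : ℝ) *
          couplingBound (A τ) (rearrangement volume (f τ)) s) ^ (2:ℝ)) ^ (1/2 : ℝ) := by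
        refine ENNReal.rpow_le_rpow (setLIntegral_mono' measurableSet_Ioi fun s hs => ?_)
          (by norm_num)
        rw [lintegral_const_mul' _ _
          (ENNReal.rpow_ne_top_of_nonneg (by norm_num) ENNReal.ofReal_ne_top), hsq]
        gcongr
        exact rearrangement_duhamel_le hf ht hs
    _ ≤ ∫⁻ τ in Ioo 0 t, (∫⁻ s in Ioi (0:ℝ), (ENNReal.ofReal (s ^ (α - 1)) ^ (1/2 : ℝ) *
          couplingBound (A τ) (rearrangement volume (f τ)) s) ^ (2:ℝ)) ^ (1/2 : ℝ) :=
        sqrt_lintegral_sq_lintegral_le (K := fun s τ => ENNReal.ofReal (s ^ (α - 1)) ^ (1/2 : ℝ) *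
          couplingBound (A τ) (rearrangement volume (f τ)) s) hK
    _ ≤ ∫⁻ τ in Ioo 0 t, ENNReal.ofReal (32 / α ^ 2 + 2 / (1 - α)) ^ (1/2 : ℝ) *
          (lornorm n (p / (p - 1)) (f τ) *
            ENNReal.ofReal (|t - τ| ^ (-(n * (1/2 - 1/p))))) := by
        refine setLIntegral_mono' measurableSet_Ioo fun τ hτ => ?_
        have hd : 0 < t - τ := sub_pos.2 hτ.2
        have hπ := Real.pi_pos
        have hAτ : 0 < A τ := by positivity
        simp_rw [hsq]
        refine (ENNReal.rpow_le_rpow (lintegral_weight_mul_sq_couplingBound_le hAτ hα0 hα1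
          measurable_rearrangement) (by norm_num : (0:ℝ) ≤ 1/2)).trans ?_
        rw [ENNReal.mul_rpow_of_nonneg _ _ (by norm_num), ENNReal.ofReal_mul (by positivity),
          ENNReal.mul_rpow_of_nonneg _ _ (by norm_num), mul_assoc, lornorm_eq n (by positivity),
          show 2 / (p / (p - 1)) - 1 = 1 - α by rw [hα]; field_simp; ring,
          mul_comm (ENNReal.ofReal (A τ ^ (2 * (1 - α))) ^ (1/2 : ℝ))]
        gcongr
        rw [ENNReal.ofReal_rpow_of_pos (by positivity), ← Real.rpow_mul hAτ.le, hA,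
          abs_of_pos hd]
        refine ENNReal.ofReal_le_ofReal ?_
        simp only
        rw [← Real.rpow_mul (by positivity), show -(n:ℝ) / 2 * (2 * (1 - α) * (1 / 2)) =
          -(n * (1/2 - 1/p)) by rw [hα]; ring]
        refine Real.rpow_le_rpow_of_nonpos hd ?_ ?_
        · nlinarith [Real.pi_gt_three]
        · have : 1 / p ≤ 1 / 2 := one_div_le_one_div_of_le two_pos hp.le
          have hn : (0:ℝ) ≤ n := n.cast_nonneg
          nlinarith
    _ = _ := lintegral_const_mul' _ _
        (ENNReal.rpow_ne_top_of_nonneg (by norm_num) ENNReal.ofReal_ne_top)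

end Duhamel

/-- dispersive/Hardy-Littlewood-Sobolev bound:
`‖∫_0^t e^{i(t-τ)Δ} f(τ) dτ‖_{L^{γ(p)}(I, L^{p,2})} ≲ ‖f‖_{L^{γ(p)'}(I, L^{p',2})}`
for any interval `I ⊆ [0,∞)` containing `0`, `2 ≤ p < 2*`. -/
theorem dispersive_HLS_bound (n : ℕ) (hn : 1 ≤ n) (p : ℝ) (hp : subcrit n p) :
    ∃ C : ℝ≥0∞, C < ∞ ∧ ∀ I : Set ℝ, I.OrdConnected → I ⊆ Ici (0:ℝ) → (0:ℝ) ∈ I →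
      ∀ f : ℝ → Rn n → ℂ, Measurable (fun q : ℝ × Rn n => f q.1 q.2) →
        timeNorm (gam n p) I (fun t => lornorm n p (duhamel n 0 f t)) ≤
          C * timeNorm (conjE (gam n p)) I (fun t => lornorm n (p / (p - 1)) (f t)) := by
  obtain ⟨hp2, hsub⟩ := hp
  have hp0 : 0 < p := by linarith
  rcases hp2.eq_or_lt with rfl | hp2
  · have hgam : gam n 2 = ∞ := by simp [gam]
    refine ⟨1, ENNReal.one_lt_top, fun I hI hI0 h0 f hf => ?_⟩
    have hIm := hI.measurableSet
    have hconj : conjE ∞ = 1 := by simp [conjE]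
    rw [hgam, hconj, one_mul, timeNorm, if_pos rfl, timeNorm, if_neg ENNReal.one_ne_top,
      show (2:ℝ) / (2 - 1) = 2 by norm_num]
    simp only [ENNReal.toReal_one, ENNReal.rpow_one, inv_one]
    refine essSup_le_of_ae_le _ (ae_restrict_of_forall_mem hIm fun t ht => ?_)
    exact (lornorm_two_duhamel_le hf (hI0 ht)).trans
      (lintegral_mono_set (Ioo_subset_Icc_self.trans (hI.out h0 ht)))
  · have hp1 : 0 < p - 1 := by linarith
    set a : ℝ := n * (1/2 - 1/p) with ha
    have hn0 : (0:ℝ) < n := by exact_mod_cast hn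
    have ha0 : 0 < a := by
      have : 1 / p < 1 / 2 := one_div_lt_one_div_of_lt two_pos hp2
      exact mul_pos hn0 (by linarith)
    have ha1 : a < 1 := by
      have h1 : n * (p - 2) < 2 * p := by
        rcases Nat.lt_or_ge n 3 with h | h
        · have : (n:ℝ) ≤ 2 := by exact_mod_cast Nat.lt_succ_iff.1 h
          nlinarith
        · have h3 : (3:ℝ) ≤ n := by exact_mod_cast h
          have := hsub h
          rw [lt_div_iff₀ (by linarith)] at this
          linarith
      have h2 : a = n * (p - 2) / (2 * p) := by rw [ha]; field_simp
      rw [h2, div_lt_one (by positivity)]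
      exact h1
    have h2a : 0 < 2 - a := by linarith
    have hgam : gam n p = ENNReal.ofReal (2 / a) := by
      rw [gam, show (n / 2 : ℝ) * (1/2 - 1/p) = a / 2 by rw [ha]; ring,
        ← ENNReal.ofReal_inv_of_pos (by positivity), inv_div]
    have hconj : conjE (ENNReal.ofReal (2 / a)) = ENNReal.ofReal (2 / (2 - a)) := by
      rw [conjE, ← ENNReal.ofReal_inv_of_pos (by positivity), inv_div, ← ENNReal.ofReal_one,
        ← ENNReal.ofReal_sub _ (by positivity),
        ← ENNReal.ofReal_inv_of_pos (by linarith)]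
      congr 1
      field_simp
    have htime : ∀ γ : ℝ, 0 < γ → ∀ (I : Set ℝ) (N : ℝ → ℝ≥0∞),
        timeNorm (ENNReal.ofReal γ) I N = (∫⁻ t in I, N t ^ γ) ^ γ⁻¹ := by
      intro γ hγ I N
      rw [timeNorm, if_neg ENNReal.ofReal_ne_top, ENNReal.toReal_ofReal hγ.le]
    set c := ENNReal.ofReal (32 / (2 / p) ^ 2 + 2 / (1 - 2 / p)) ^ (1/2 : ℝ) with hc
    have hct : c ≠ ∞ := ENNReal.rpow_ne_top_of_nonneg (by norm_num) ENNReal.ofReal_ne_top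
    refine ⟨c * (2 * ENNReal.ofReal (2 / (1 - a) + 2)),
      ENNReal.mul_lt_top hct.lt_top (ENNReal.mul_lt_top (by simp) ENNReal.ofReal_lt_top),
      fun I hI hI0 h0 f hf => ?_⟩
    have hIm := hI.measurableSet
    set N : ℝ → ℝ≥0∞ := fun τ => lornorm n (p / (p - 1)) (f τ) with hN
    have hNm : Measurable N := measurable_lornorm_section (by positivity) hf
    rw [hgam, hconj, htime _ (by positivity), htime _ (by positivity), inv_div, inv_div]
    have hbound : ∀ t ∈ I, lornorm n p (duhamel n 0 f t) ≤
        c * ∫⁻ τ, I.indicator N τ * ENNReal.ofReal (|t - τ| ^ (-a)) := by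
      intro t ht
      refine (lornorm_duhamel_le hp2 hf (hI0 ht)).trans (mul_le_mul_right ?_ c)
      rw [← lintegral_indicator measurableSet_Ioo]
      refine lintegral_mono fun τ => ?_
      by_cases hτ : τ ∈ Ioo 0 t
      · rw [indicator_of_mem hτ, indicator_of_mem (hI.out h0 ht (Ioo_subset_Icc_self hτ))]
      · rw [indicator_of_notMem hτ]
        exact zero_le
    calc _ ≤ (∫⁻ t, (c * ∫⁻ τ, I.indicator N τ * ENNReal.ofReal (|t - τ| ^ (-a))) ^ (2 / a)) ^
            (a / 2) := by
          refine ENNReal.rpow_le_rpow ?_ (by positivity)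
          refine (setLIntegral_mono' hIm fun t ht => ?_).trans (setLIntegral_le_lintegral I _)
          exact ENNReal.rpow_le_rpow (hbound t ht) (by positivity)
      _ = c * (∫⁻ t, (∫⁻ τ, I.indicator N τ * ENNReal.ofReal (|t - τ| ^ (-a))) ^ (2 / a)) ^
            (a / 2) := by
          simp_rw [ENNReal.mul_rpow_of_nonneg c _ (show (0:ℝ) ≤ 2 / a by positivity)]
          rw [lintegral_const_mul' _ _ (ENNReal.rpow_ne_top_of_nonneg (by positivity) hct),
            ENNReal.mul_rpow_of_nonneg _ _ (by positivity), ← ENNReal.rpow_mul,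
            show 2 / a * (a / 2) = 1 by field_simp, ENNReal.rpow_one]
      _ ≤ c * (2 * ENNReal.ofReal (2 / (1 - a) + 2) *
            (∫⁻ τ, I.indicator N τ ^ (2 / (2 - a))) ^ ((2 - a) / 2)) := by
          gcongr
          exact lintegral_rpow_riesz_le ha0 ha1 (hNm.indicator hIm)
      _ = _ := by
          rw [← mul_assoc, ← lintegral_indicator hIm]
          congr 3
          ext τ
          by_cases hτ : τ ∈ I
          · rw [indicator_of_mem hτ, indicator_of_mem hτ]
          · rw [indicator_of_notMem hτ, indicator_of_notMem hτ,
              ENNReal.zero_rpow_of_pos (by positivity)]
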